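/- (Existence for general symmetric Lévy generators.) Let T > 0, let φ : ℝ → ℝ be continuous and nondecreasing, let μ be a Lévy measure on ℝ^N \ {0}, let P ∈ ℕ and σ = (σ₁, …, σ_P) ∈ ℝ^{N×P}, and let u₀ ∈ L^∞(ℝ^N) ∩ L¹(ℝ^N). Define L^σ[ψ](x) = tr[σσᵀ D²ψ(x)] for ψ ∈ C_c^∞(ℝ^N). Then there exists a distributional solution u ∈ L^∞(Q_T) ∩ L¹(Q_T) ∩ C([0,T]; L¹_loc(ℝ^N)) of ∂_t u − (L^σ + L^μ)[φ(u)] = 0 in Q_T with initial datum u₀, i.e. ∫₀^T ∫_{ℝ^N} ( u ∂_t ψ + φ(u)( tr[σσᵀ D²ψ(·,t)] + L^μ[ψ(·,t)] ) ) dx dt + ∫_{ℝ^N} u₀(x) ψ(x,0) dx = 0 for all ψ ∈ C_c^∞(ℝ^N × [0,T)). -/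

import Mathlib

open MeasureTheory Set Filter

noncomputable section

/-- Euclidean space `ℝ^N`. -/
abbrev Euc (N : ℕ) := EuclideanSpace ℝ (Fin N)

variable {N : ℕ}

/-- `μ` is a (symmetric) Lévy measure on `ℝ^N ∖ {0}` : it is a nonnegative measure giving no
mass to `{0}`, symmetric (`μ(−B) = μ(B)`), and `∫ min(|z|²,1) dμ(z) < ∞`. -/
def IsLevyMeasure (μ : Measure (Euc N)) : Prop :=
  μ {0} = 0 ∧ μ.map (fun z => -z) = μ ∧
    ∫⁻ z, ENNReal.ofReal (min (‖z‖ ^ 2) 1) ∂μ ≠ ⊤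

/-- The nonlocal operator
`L^μ[ψ](x) = ∫ (ψ(x+z) − ψ(x) − z·Dψ(x) 1_{|z|≤1}) dμ(z)`. -/
def Lop (μ : Measure (Euc N)) (ψ : Euc N → ℝ) (x : Euc N) : ℝ :=
  ∫ z, (ψ (x + z) - ψ x - (if ‖z‖ ≤ 1 then fderiv ℝ ψ x z else 0)) ∂μ

/-- `ψ ∈ C_c^∞(ℝ^N)`. -/
def IsTestFn (ψ : Euc N → ℝ) : Prop :=
  ContDiff ℝ (⊤ : ℕ∞) ψ ∧ HasCompactSupport ψ

/-- `ψ ∈ C_c^∞(ℝ^N × [0,T))` : smooth, compactly supported, and the support stays away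
from `t = T` (but may touch `t = 0`). -/
def IsSTTestFn (T : ℝ) (ψ : Euc N → ℝ → ℝ) : Prop :=
  ContDiff ℝ (⊤ : ℕ∞) (Function.uncurry ψ) ∧ HasCompactSupport (Function.uncurry ψ) ∧
    tsupport (Function.uncurry ψ) ⊆ {p : Euc N × ℝ | p.2 < T}

/-- `ψ ∈ C_c^∞(Q_T)` : smooth, compactly supported inside the open cylinder
`ℝ^N × (0,T)`. -/
def IsIntTestFn (T : ℝ) (ψ : Euc N → ℝ → ℝ) : Prop :=
  ContDiff ℝ (⊤ : ℕ∞) (Function.uncurry ψ) ∧ HasCompactSupport (Function.uncurry ψ) ∧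
    tsupport (Function.uncurry ψ) ⊆ {p : Euc N × ℝ | 0 < p.2 ∧ p.2 < T}

/-- The natural measure on the cylinder `Q_T = ℝ^N × (0,T)`. -/
def QTvol (N : ℕ) (T : ℝ) : Measure (Euc N × ℝ) :=
  (volume : Measure (Euc N)).prod ((volume : Measure ℝ).restrict (Ioo 0 T))

/-- `u ∈ L^∞(Q_T)`. -/
def MemLinfQT (T : ℝ) (u : Euc N → ℝ → ℝ) : Prop :=
  AEStronglyMeasurable (fun p : Euc N × ℝ => u p.1 p.2) (QTvol N T) ∧
    ∃ C : ℝ, ∀ᵐ p ∂(QTvol N T), |u p.1 p.2| ≤ C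

/-- `u ∈ L¹(Q_T)`. -/
def MemL1QT (T : ℝ) (u : Euc N → ℝ → ℝ) : Prop :=
  Integrable (fun p : Euc N × ℝ => u p.1 p.2) (QTvol N T)

/-- `u ∈ C([0,T]; L¹_loc(ℝ^N))` : for every compact `K`, `t ↦ u(·,t)` is continuous
from `[0,T]` into `L¹(K)`. -/
def MemCL1loc (T : ℝ) (u : Euc N → ℝ → ℝ) : Prop :=
  ∀ K : Set (Euc N), IsCompact K →
    (∀ t ∈ Icc (0 : ℝ) T, IntegrableOn (fun x => u x t) K) ∧
    ∀ t ∈ Icc (0 : ℝ) T,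
      Tendsto (fun s => ∫ x in K, |u x s - u x t|) (nhdsWithin t (Icc 0 T)) (nhds 0)

/-- `u` is a distributional solution of `∂_t u − A[φ(u)] = 0` in `Q_T` with initial
datum `u0` : for all `ψ ∈ C_c^∞(ℝ^N × [0,T))`,
`∫₀^T ∫ (u ∂_t ψ + φ(u) A[ψ(·,t)]) dx dt + ∫ u0(x) ψ(x,0) dx = 0`. -/
def IsDistSolOp (T : ℝ) (A : (Euc N → ℝ) → Euc N → ℝ) (φ : ℝ → ℝ)
    (u0 : Euc N → ℝ) (u : Euc N → ℝ → ℝ) : Prop :=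
  ∀ ψ : Euc N → ℝ → ℝ, IsSTTestFn T ψ →
    (∫ t in Ioo (0 : ℝ) T, ∫ x,
        (u x t * deriv (ψ x) t + φ (u x t) * A (fun y => ψ y t) x))
      + ∫ x, u0 x * ψ x 0 = 0

/-- `u0 ∈ L^∞(ℝ^N)`. -/
def MemLinfRn (u0 : Euc N → ℝ) : Prop :=
  AEStronglyMeasurable u0 (volume : Measure (Euc N)) ∧
    ∃ C : ℝ, ∀ᵐ x : Euc N ∂volume, |u0 x| ≤ C

end
noncomputable section
/-- The local operator `L^σ[ψ](x) = tr[σσᵀ D²ψ(x)] = ∑_{i=1}^P σ_iᵀ D²ψ(x) σ_i`. -/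
def Lsigma {N : ℕ} (P : ℕ) (σ : Fin P → Euc N) (ψ : Euc N → ℝ) (x : Euc N) : ℝ :=
  ∑ i : Fin P, fderiv ℝ (fun y => fderiv ℝ ψ y (σ i)) x (σ i)
end

open MeasureTheory Set Filter
open scoped Topology ENNReal

noncomputable section

variable {N : ℕ}

/-- The generator `f ↦ ∫ (f(· + z) - f) dν(z)` of a compound Poisson process. -/
def diffOp (ν : Measure (Euc N)) (f : Euc N → ℝ) (x : Euc N) : ℝ :=
  ∫ z, (f (x + z) - f x) ∂ν

/-- One explicit Euler step of size `τ` for `∂_t u = diffOp ν (g ∘ u)`. -/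
def eulerStep (ν : Measure (Euc N)) (g : ℝ → ℝ) (τ : ℝ) (u : Euc N → ℝ) (x : Euc N) : ℝ :=
  u x + τ * diffOp ν (fun y => g (u y)) x

lemma integrable_of_bound {α : Type*} [MeasurableSpace α] {ν : Measure α} [IsFiniteMeasure ν]
    {f : α → ℝ} (hf : Measurable f) {C : ℝ} (hC : ∀ x, |f x| ≤ C) : Integrable f ν :=
  Integrable.of_bound hf.aestronglyMeasurable C (Eventually.of_forall hC)

lemma diffOp_eq {ν : Measure (Euc N)} [IsFiniteMeasure ν] {f : Euc N → ℝ} (hf : Measurable f)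
    {C : ℝ} (hC : ∀ x, |f x| ≤ C) (x : Euc N) :
    diffOp ν f x = (∫ z, f (x + z) ∂ν) - ν.real univ * f x := by
  unfold diffOp
  rw [integral_sub _ (integrable_const _), integral_const, smul_eq_mul]
  exact integrable_of_bound (by fun_prop) (fun z => hC (x + z))

lemma measurable_diffOp {ν : Measure (Euc N)} [SFinite ν] {f : Euc N → ℝ}
    (hf : Measurable f) : Measurable (diffOp ν f) := by
  have h : StronglyMeasurable (Function.uncurry fun x z : Euc N => f (x + z) - f x) := by
    apply Measurable.stronglyMeasurable
    unfold Function.uncurry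
    fun_prop
  exact h.integral_prod_right.measurable

lemma measurable_eulerStep {ν : Measure (Euc N)} [SFinite ν] {g : ℝ → ℝ} (hg : Measurable g)
    (τ : ℝ) {u : Euc N → ℝ} (hu : Measurable u) : Measurable (eulerStep ν g τ u) :=
  hu.add ((measurable_diffOp (hg.comp hu)).const_mul τ)

lemma eulerStep_shift (ν : Measure (Euc N)) (g : ℝ → ℝ) (τ : ℝ) (u : Euc N → ℝ) (y : Euc N) :
    eulerStep ν g τ (fun x => u (x + y)) = fun x => eulerStep ν g τ u (x + y) := by
  funext x
  simp only [eulerStep, diffOp, add_right_comm]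

lemma eulerStep_zero (ν : Measure (Euc N)) (g : ℝ → ℝ) (τ : ℝ) :
    eulerStep ν g τ (fun _ => 0) = fun _ => 0 := by
  funext x
  simp [eulerStep, diffOp]

/-- Data of a monotone explicit scheme: `g` is bounded, nondecreasing and Lipschitz, and the
time step satisfies the stability restriction. -/
structure StableStep (ν : Measure (Euc N)) (g : ℝ → ℝ) (τ : ℝ) (C : ℝ) : Prop where
  finite : IsFiniteMeasure ν
  symm : ν.map (fun z => -z) = ν
  mono : Monotone g
  bound : ∀ r, |g r| ≤ C
  pos : 0 < τ
  cont : Continuous g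
  stable : ∀ a b, a ≤ b → τ * ν.real univ * (g b - g a) ≤ b - a

namespace StableStep

variable {ν : Measure (Euc N)} {g : ℝ → ℝ} {τ C : ℝ}

lemma step_eq (h : StableStep ν g τ C) {u : Euc N → ℝ} (hu : Measurable u) (x : Euc N) :
    eulerStep ν g τ u x =
      (u x - τ * ν.real univ * g (u x)) + τ * ∫ z, g (u (x + z)) ∂ν := by
  have := h.finite
  rw [eulerStep, diffOp_eq (f := fun y => g (u y)) (h.cont.measurable.comp hu)
    (fun x => h.bound (u x))]
  ring

lemma abs_step_le (h : StableStep ν g τ C) {u : Euc N → ℝ} (hu : Measurable u) {M : ℝ}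
    (hM : ∀ x, |u x| ≤ M) (x : Euc N) : |eulerStep ν g τ u x| ≤ M := by
  have := h.finite
  have hint : Integrable (fun z => g (u (x + z))) ν :=
    integrable_of_bound (h.cont.measurable.comp (by fun_prop)) (fun z => h.bound _)
  have up : ∫ z, g (u (x + z)) ∂ν ≤ ν.real univ * g M := by
    have := integral_mono hint (integrable_const (g M))
      (fun z => h.mono (abs_le.1 (hM (x + z))).2)
    simpa using this
  have lo : ν.real univ * g (-M) ≤ ∫ z, g (u (x + z)) ∂ν := by
    have := integral_mono (integrable_const (g (-M))) hint
      (fun z => h.mono (abs_le.1 (hM (x + z))).1)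
    simpa using this
  have h1 := h.stable _ _ (abs_le.1 (hM x)).1
  have h2 := h.stable _ _ (abs_le.1 (hM x)).2
  have up' := mul_le_mul_of_nonneg_left up h.pos.le
  have lo' := mul_le_mul_of_nonneg_left lo h.pos.le
  rw [h.step_eq hu, abs_le]
  constructor <;> nlinarith

lemma abs_step_sub_le (h : StableStep ν g τ C) {u v : Euc N → ℝ} (hu : Measurable u)
    (hv : Measurable v) (x : Euc N) :
    |eulerStep ν g τ u x - eulerStep ν g τ v x| + τ * ν.real univ * |g (u x) - g (v x)| ≤
      |u x - v x| + τ * ∫ z, |g (u (x + z)) - g (v (x + z))| ∂ν := by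
  have := h.finite
  have hint : ∀ {u : Euc N → ℝ}, Measurable u → Integrable (fun z => g (u (x + z))) ν :=
    fun hu => integrable_of_bound (h.cont.measurable.comp (by fun_prop)) (fun z => h.bound _)
  have key : |(u x - τ * ν.real univ * g (u x)) - (v x - τ * ν.real univ * g (v x))| +
      τ * ν.real univ * |g (u x) - g (v x)| = |u x - v x| := by
    rcases le_total (u x) (v x) with huv | huv
    · have h1 := h.stable _ _ huv
      have h2 := h.mono huv
      rw [abs_of_nonpos (by nlinarith), abs_of_nonpos (by linarith), abs_of_nonpos (by linarith)]
      ring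
    · have h1 := h.stable _ _ huv
      have h2 := h.mono huv
      rw [abs_of_nonneg (by nlinarith), abs_of_nonneg (by linarith), abs_of_nonneg (by linarith)]
      ring
  have hI : |(∫ z, g (u (x + z)) ∂ν) - ∫ z, g (v (x + z)) ∂ν| ≤
      ∫ z, |g (u (x + z)) - g (v (x + z))| ∂ν := by
    rw [← integral_sub (hint hu) (hint hv)]
    exact abs_integral_le_integral_abs
  have hI' := mul_le_mul_of_nonneg_left hI h.pos.le
  rw [h.step_eq hu, h.step_eq hv]
  have tri := abs_add_le ((u x - τ * ν.real univ * g (u x)) - (v x - τ * ν.real univ * g (v x)))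
    (τ * ((∫ z, g (u (x + z)) ∂ν) - ∫ z, g (v (x + z)) ∂ν))
  rw [abs_mul, abs_of_pos h.pos] at tri
  have e : u x - τ * ν.real univ * g (u x) + τ * ∫ z, g (u (x + z)) ∂ν -
      (v x - τ * ν.real univ * g (v x) + τ * ∫ z, g (v (x + z)) ∂ν) =
      ((u x - τ * ν.real univ * g (u x)) - (v x - τ * ν.real univ * g (v x))) +
      τ * ((∫ z, g (u (x + z)) ∂ν) - ∫ z, g (v (x + z)) ∂ν) := by ring
  rw [e]
  linarith

end StableStep

lemma lintegral_lintegral_shift (ν : Measure (Euc N)) [SFinite ν] {F : Euc N → ℝ≥0∞}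
    (hF : Measurable F) :
    ∫⁻ x, ∫⁻ z, F (x + z) ∂ν = ν univ * ∫⁻ x, F x := by
  rw [lintegral_lintegral_swap (by unfold Function.uncurry; fun_prop)]
  simp_rw [lintegral_add_right_eq_self]
  rw [lintegral_const, mul_comm]

namespace StableStep

variable {ν : Measure (Euc N)} {g : ℝ → ℝ} {τ C : ℝ}

lemma abs_lipschitz (h : StableStep ν g τ C) (a b : ℝ) :
    τ * ν.real univ * |g a - g b| ≤ |a - b| := by
  rcases le_total a b with hab | hab
  · rw [abs_of_nonpos (sub_nonpos.2 (h.mono hab)), abs_of_nonpos (sub_nonpos.2 hab)]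
    linarith [h.stable _ _ hab]
  · rw [abs_of_nonneg (sub_nonneg.2 (h.mono hab)), abs_of_nonneg (sub_nonneg.2 hab)]
    linarith [h.stable _ _ hab]

lemma lintegral_step_sub_le (h : StableStep ν g τ C) {u v : Euc N → ℝ} (hu : Measurable u)
    (hv : Measurable v) :
    ∫⁻ x, ENNReal.ofReal |eulerStep ν g τ u x - eulerStep ν g τ v x| ≤
      ∫⁻ x, ENNReal.ofReal |u x - v x| := by
  have := h.finite
  by_cases htop : ∫⁻ x, ENNReal.ofReal |u x - v x| = ∞
  · rw [htop]; exact le_top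
  have hg := h.cont.measurable
  have hSu := measurable_eulerStep (ν := ν) hg τ hu
  have hSv := measurable_eulerStep (ν := ν) hg τ hv
  set F : Euc N → ℝ≥0∞ := fun x => ENNReal.ofReal |g (u x) - g (v x)| with hFdef
  have hF : Measurable F := by fun_prop
  have pt : ∀ x, ENNReal.ofReal |eulerStep ν g τ u x - eulerStep ν g τ v x| +
      ENNReal.ofReal τ * ν univ * F x ≤
      ENNReal.ofReal |u x - v x| + ENNReal.ofReal τ * ∫⁻ z, F (x + z) ∂ν := by
    intro x
    have hI : Integrable (fun z => |g (u (x + z)) - g (v (x + z))|) ν :=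
      integrable_of_bound (C := C + C) (by fun_prop) (fun z => by
        rw [abs_abs]
        exact (abs_sub _ _).trans (add_le_add (h.bound _) (h.bound _)))
    have e1 : ∫⁻ z, F (x + z) ∂ν =
        ENNReal.ofReal (∫ z, |g (u (x + z)) - g (v (x + z))| ∂ν) :=
      (ofReal_integral_eq_lintegral_ofReal hI (Eventually.of_forall fun z => abs_nonneg _)).symm
    have e2 : ν univ = ENNReal.ofReal (ν.real univ) := by simp
    have hτ := h.pos.le
    rw [e1, e2, hFdef]
    simp only
    rw [← ENNReal.ofReal_mul hτ, ← ENNReal.ofReal_mul (by positivity), ← ENNReal.ofReal_mul hτ,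
      ← ENNReal.ofReal_add (by positivity) (by positivity),
      ← ENNReal.ofReal_add (by positivity) (mul_nonneg hτ (integral_nonneg fun _ => abs_nonneg _))]
    exact ENNReal.ofReal_le_ofReal (h.abs_step_sub_le hu hv x)
  have tot := lintegral_mono (μ := (volume : Measure (Euc N))) pt
  rw [lintegral_add_left (by fun_prop), lintegral_add_left (by fun_prop),
    lintegral_const_mul _ hF, lintegral_const_mul _ (by
      exact Measurable.lintegral_prod_right' (f := fun p : Euc N × Euc N => F (p.1 + p.2))
        (by fun_prop)),
    lintegral_lintegral_shift ν hF, ← mul_assoc] at tot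
  refine (ENNReal.add_le_add_iff_right ?_).1 tot
  rw [← lintegral_const_mul _ hF]
  refine ne_top_of_le_ne_top htop (lintegral_mono fun x => ?_)
  have e2 : ν univ = ENNReal.ofReal (ν.real univ) := by simp
  rw [e2, hFdef]
  simp only
  rw [← ENNReal.ofReal_mul h.pos.le,
    ← ENNReal.ofReal_mul (mul_nonneg h.pos.le measureReal_nonneg)]
  exact ENNReal.ofReal_le_ofReal (h.abs_lipschitz _ _)

end StableStep

lemma integral_mul_diffOp {ν : Measure (Euc N)} [IsFiniteMeasure ν]
    (hsymm : ν.map (fun z => -z) = ν) {f ψ : Euc N → ℝ} (hf : Measurable f) {C : ℝ}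
    (hC : ∀ x, |f x| ≤ C) (hψ : Integrable ψ) :
    ∫ x, ψ x * diffOp ν f x = ∫ x, f x * diffOp ν ψ x := by
  have hψν : Integrable (fun p : Euc N × Euc N => ψ p.1)
      ((volume : Measure (Euc N)).prod ν) := hψ.comp_fst ν
  have hmp : MeasurePreserving (fun p : Euc N × Euc N => (p.1 + p.2, -p.2))
      ((volume : Measure (Euc N)).prod ν) ((volume : Measure (Euc N)).prod ν) := by
    refine ⟨by fun_prop, ?_⟩
    refine Measure.ext_of_lintegral _ fun F hF => ?_
    rw [lintegral_map hF (by fun_prop), lintegral_prod_symm _ (by fun_prop),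
      lintegral_prod_symm _ (by fun_prop)]
    simp only
    have : ∀ z : Euc N, ∫⁻ x, F (x + z, -z) = ∫⁻ x, F (x, -z) := fun z =>
      lintegral_add_right_eq_self (fun x => F (x, -z)) z
    simp_rw [this]
    conv_rhs => rw [← hsymm]
    rw [lintegral_map _ (by fun_prop)]
    exact Measurable.lintegral_prod_left' hF
  have bdd : ∀ {k h : Euc N × Euc N → ℝ}, Measurable k → (∀ p, |k p| ≤ C) →
      Integrable h ((volume : Measure (Euc N)).prod ν) →
      Integrable (fun p => k p * h p) ((volume : Measure (Euc N)).prod ν) :=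
    fun hk hb hh => hh.bdd_mul hk.aestronglyMeasurable (c := C) (Eventually.of_forall hb)
  have i1 : Integrable (fun p : Euc N × Euc N => f (p.1 + p.2) * ψ p.1)
      ((volume : Measure (Euc N)).prod ν) := bdd (by fun_prop) (fun _ => hC _) hψν
  have i2 : Integrable (fun p : Euc N × Euc N => f p.1 * ψ p.1)
      ((volume : Measure (Euc N)).prod ν) := bdd (by fun_prop) (fun _ => hC _) hψν
  have i3 : Integrable (fun p : Euc N × Euc N => f p.1 * ψ (p.1 + p.2))
      ((volume : Measure (Euc N)).prod ν) := by
    have := (hmp.integrable_comp i1.aestronglyMeasurable).2 i1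
    refine this.congr (Eventually.of_forall fun p => ?_)
    simp
  have e3 : ∫ p, f (p.1 + p.2) * ψ p.1 ∂((volume : Measure (Euc N)).prod ν) =
      ∫ p, f p.1 * ψ (p.1 + p.2) ∂((volume : Measure (Euc N)).prod ν) := by
    rw [← hmp.map_eq, integral_map hmp.measurable.aemeasurable
      (by rw [hmp.map_eq]; exact i1.aestronglyMeasurable), hmp.map_eq]
    simp
  have l : ∫ x, ψ x * diffOp ν f x =
      ∫ p, (f (p.1 + p.2) * ψ p.1 - f p.1 * ψ p.1) ∂((volume : Measure (Euc N)).prod ν) := by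
    rw [integral_prod (fun p : Euc N × Euc N => f (p.1 + p.2) * ψ p.1 - f p.1 * ψ p.1)
      (i1.sub i2)]
    refine integral_congr_ae (Eventually.of_forall fun x => ?_)
    simp only [diffOp]
    rw [← integral_const_mul]
    refine integral_congr_ae (Eventually.of_forall fun z => ?_)
    simp only; ring
  have r : ∫ x, f x * diffOp ν ψ x =
      ∫ p, (f p.1 * ψ (p.1 + p.2) - f p.1 * ψ p.1) ∂((volume : Measure (Euc N)).prod ν) := by
    rw [integral_prod (fun p : Euc N × Euc N => f p.1 * ψ (p.1 + p.2) - f p.1 * ψ p.1)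
      (i3.sub i2)]
    refine integral_congr_ae (Eventually.of_forall fun x => ?_)
    simp only [diffOp]
    rw [← integral_const_mul]
    refine integral_congr_ae (Eventually.of_forall fun z => ?_)
    simp only; ring
  rw [l, r, integral_sub i1 i2, integral_sub i3 i2, e3]

/-- Iterates of the explicit Euler scheme. -/
def euler (ν : Measure (Euc N)) (g : ℝ → ℝ) (τ : ℝ) (u : Euc N → ℝ) (k : ℕ) : Euc N → ℝ :=
  (eulerStep ν g τ)^[k] u

namespace StableStep

variable {ν : Measure (Euc N)} {g : ℝ → ℝ} {τ C : ℝ}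

lemma measurable_euler (h : StableStep ν g τ C) {u : Euc N → ℝ} (hu : Measurable u) (k : ℕ) :
    Measurable (euler ν g τ u k) := by
  have := h.finite
  induction k with
  | zero => exact hu
  | succ k ih =>
    rw [euler, Function.iterate_succ_apply']
    exact measurable_eulerStep h.cont.measurable τ ih

lemma abs_euler_le (h : StableStep ν g τ C) {u : Euc N → ℝ} (hu : Measurable u) {M : ℝ}
    (hM : ∀ x, |u x| ≤ M) (k : ℕ) (x : Euc N) : |euler ν g τ u k x| ≤ M := by
  induction k generalizing x with
  | zero => exact hM x
  | succ k ih =>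
    rw [euler, Function.iterate_succ_apply']
    exact h.abs_step_le (h.measurable_euler hu k) ih x

lemma lintegral_euler_sub_le (h : StableStep ν g τ C) {u v : Euc N → ℝ} (hu : Measurable u)
    (hv : Measurable v) (k : ℕ) :
    ∫⁻ x, ENNReal.ofReal |euler ν g τ u k x - euler ν g τ v k x| ≤
      ∫⁻ x, ENNReal.ofReal |u x - v x| := by
  induction k with
  | zero => exact le_rfl
  | succ k ih =>
    simp only [euler, Function.iterate_succ_apply']
    exact (h.lintegral_step_sub_le (h.measurable_euler hu k) (h.measurable_euler hv k)).trans ih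

lemma lintegral_euler_shift_le (h : StableStep ν g τ C) {u : Euc N → ℝ} (hu : Measurable u)
    (k : ℕ) (y : Euc N) :
    ∫⁻ x, ENNReal.ofReal |euler ν g τ u k (x + y) - euler ν g τ u k x| ≤
      ∫⁻ x, ENNReal.ofReal |u (x + y) - u x| := by
  have e : ∀ k, euler ν g τ (fun x => u (x + y)) k = fun x => euler ν g τ u k (x + y) := by
    intro k
    induction k with
    | zero => rfl
    | succ k ih =>
      simp only [euler, Function.iterate_succ_apply'] at ih ⊢
      rw [ih, eulerStep_shift]
  have := h.lintegral_euler_sub_le (u := fun x => u (x + y)) (by fun_prop) hu k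
  rwa [e] at this

lemma lintegral_euler_le (h : StableStep ν g τ C) {u : Euc N → ℝ} (hu : Measurable u) (k : ℕ) :
    ∫⁻ x, ENNReal.ofReal |euler ν g τ u k x| ≤ ∫⁻ x, ENNReal.ofReal |u x| := by
  have e : ∀ k, euler ν g τ (fun _ => 0) k = fun _ => 0 := by
    intro k
    induction k with
    | zero => rfl
    | succ k ih =>
      simp only [euler, Function.iterate_succ_apply'] at ih ⊢
      rw [ih, eulerStep_zero]
  have := h.lintegral_euler_sub_le hu (v := fun _ => 0) (by fun_prop) k
  rw [e] at this
  simpa using this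

lemma integral_mul_euler_succ (h : StableStep ν g τ C) {u ψ : Euc N → ℝ} (hu : Measurable u)
    {M : ℝ} (hM : ∀ x, |u x| ≤ M) (hψ : Integrable ψ) (k : ℕ) :
    ∫ x, ψ x * euler ν g τ u (k + 1) x = (∫ x, ψ x * euler ν g τ u k x) +
      τ * ∫ x, g (euler ν g τ u k x) * diffOp ν ψ x := by
  have := h.finite
  have hm := h.measurable_euler hu
  have hint : ∀ k, Integrable (fun x => ψ x * euler ν g τ u k x) := fun k =>
    hψ.mul_bdd (c := M) (hm k).aestronglyMeasurable
      (Eventually.of_forall fun x => h.abs_euler_le hu hM k x)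
  have e : ∀ x, euler ν g τ u (k + 1) x = euler ν g τ u k x +
      τ * diffOp ν (fun y => g (euler ν g τ u k y)) x := by
    intro x
    simp only [euler, Function.iterate_succ_apply']
    rfl
  have e' : ∀ x, ψ x * euler ν g τ u (k + 1) x - ψ x * euler ν g τ u k x =
      τ * (ψ x * diffOp ν (fun y => g (euler ν g τ u k y)) x) := by
    intro x; rw [e]; ring
  rw [← integral_mul_diffOp h.symm (f := fun y => g (euler ν g τ u k y))
    (h.cont.measurable.comp (hm k)) (fun x => h.bound _) hψ, ← sub_eq_iff_eq_add',
    ← integral_sub (hint _) (hint _), ← integral_const_mul]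
  simp_rw [e']

end StableStep

end

noncomputable section

variable {N : ℕ}

/-- The `L¹` distance on the closed ball of radius `R` about the origin. -/
def ballDist (R : ℝ) (f g : Euc N → ℝ) : ℝ :=
  ∫ x in Metric.closedBall (0 : Euc N) R, |f x - g x|

/-- Measurable functions bounded by `M`. -/
def BddMeas (M : ℝ) (f : Euc N → ℝ) : Prop :=
  Measurable f ∧ ∀ x, |f x| ≤ M

lemma BddMeas.integrableOn {M : ℝ} {f : Euc N → ℝ} (hf : BddMeas M f) (R : ℝ) :
    IntegrableOn f (Metric.closedBall 0 R) := by
  have : IsFiniteMeasure ((volume : Measure (Euc N)).restrict (Metric.closedBall 0 R)) :=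
    ⟨by simpa using (isCompact_closedBall (0 : Euc N) R).measure_lt_top⟩
  exact integrable_of_bound hf.1 hf.2

lemma ballDist_nonneg (R : ℝ) (f g : Euc N → ℝ) : 0 ≤ ballDist R f g :=
  integral_nonneg fun _ => abs_nonneg _

lemma ballDist_comm (R : ℝ) (f g : Euc N → ℝ) : ballDist R f g = ballDist R g f := by
  simp only [ballDist, abs_sub_comm]

lemma ballDist_triangle {M : ℝ} {f g h : Euc N → ℝ} (hf : BddMeas M f) (hg : BddMeas M g)
    (hh : BddMeas M h) (R : ℝ) : ballDist R f h ≤ ballDist R f g + ballDist R g h := by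
  have hi := fun {f : Euc N → ℝ} (hf : BddMeas M f) => hf.integrableOn R
  unfold ballDist
  refine (integral_mono ((hi hf).sub (hi hh)).abs
    (((hi hf).sub (hi hg)).abs.add ((hi hg).sub (hi hh)).abs) fun x => ?_).trans_eq
    (integral_add ((hi hf).sub (hi hg)).abs ((hi hg).sub (hi hh)).abs)
  exact abs_sub_le _ _ _

lemma ballDist_le_of_lintegral {f g : Euc N → ℝ} (hf : Measurable f) (hg : Measurable g) {ε : ℝ}
    (hε : 0 ≤ ε) (h : ∫⁻ x, ENNReal.ofReal |f x - g x| ≤ ENNReal.ofReal ε) (R : ℝ) :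
    ballDist R f g ≤ ε := by
  unfold ballDist
  rw [integral_eq_lintegral_of_nonneg_ae (Eventually.of_forall fun _ => abs_nonneg _)
    (by fun_prop)]
  refine ENNReal.toReal_le_of_le_ofReal hε ((setLIntegral_le_lintegral _ _).trans h)

lemma ballDist_le_of_forall {f g : Euc N → ℝ} {R ε : ℝ}
    (h : ∀ x ∈ Metric.closedBall (0 : Euc N) R, |f x - g x| ≤ ε) :
    ballDist R f g ≤ ε * volume.real (Metric.closedBall (0 : Euc N) R) := by
  unfold ballDist
  have := norm_setIntegral_le_of_norm_le_const (μ := volume) (f := fun x => |f x - g x|) (C := ε)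
    (isCompact_closedBall (0 : Euc N) R).measure_lt_top (fun x hx => by simpa using h x hx)
  exact (le_abs_self _).trans this

lemma ofReal_abs_integral_le {α : Type*} [MeasurableSpace α] {m : Measure α} (f : α → ℝ) :
    ENNReal.ofReal |∫ x, f x ∂m| ≤ ∫⁻ x, ENNReal.ofReal |f x| ∂m := by
  simpa [Real.enorm_eq_ofReal_abs] using enorm_integral_le_lintegral_enorm (μ := m) f

/-- Continuity of translations in `L¹`. -/
lemma tendsto_lintegral_shift {f : Euc N → ℝ} (hf : Integrable f) :
    Tendsto (fun y : Euc N => ∫⁻ x, ENNReal.ofReal |f (x + y) - f x|) (𝓝 0) (𝓝 0) := by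
  let g : C(Euc N, C(Euc N, Euc N)) :=
    (ContinuousMap.mk (fun p : Euc N × Euc N => p.2 + p.1) (by fun_prop)).curry
  have hgm : ∀ y, MeasurePreserving (g y) (volume : Measure (Euc N)) volume := fun y =>
    measurePreserving_add_right volume y
  have hF := memLp_one_iff_integrable.2 hf
  have h := (tendsto_const_nhds (x := hF.toLp f) (f := 𝓝 (0 : Euc N))).compMeasurePreservingLp
    (g.continuous.tendsto 0) hgm (hgm 0) ENNReal.one_ne_top
  rw [tendsto_iff_edist_tendsto_0] at h
  refine h.congr fun y => ?_
  rw [Lp.toLp_compMeasurePreserving, Lp.toLp_compMeasurePreserving, Lp.edist_toLp_toLp,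
    eLpNorm_one_eq_lintegral_enorm]
  refine lintegral_congr fun x => ?_
  simp [g, Real.enorm_eq_ofReal_abs]

lemma exists_mollifier {r : ℝ} (hr : 0 < r) : ∃ ρ : Euc N → ℝ, IsTestFn ρ ∧ (∀ x, 0 ≤ ρ x) ∧
    ∫ x, ρ x = 1 ∧ ∀ x, r ≤ ‖x‖ → ρ x = 0 := by
  let f : ContDiffBump (0 : Euc N) := ⟨r / 2, r, by positivity, by linarith⟩
  refine ⟨f.normed volume, ⟨f.contDiff_normed, f.hasCompactSupport_normed⟩, f.nonneg_normed,
    f.integral_normed, fun x hx => ?_⟩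
  have : x ∉ Function.support (f.normed volume) := by
    rw [f.support_normed_eq]
    simpa using hx
  simpa using this

lemma IsTestFn.integrable {ρ : Euc N → ℝ} (h : IsTestFn ρ) : Integrable ρ :=
  h.1.continuous.integrable_of_hasCompactSupport h.2

/-- Space mollification of `u` with kernel `ρ`. -/
def mollify (ρ u : Euc N → ℝ) (x : Euc N) : ℝ := ∫ y, ρ (y - x) * u y

lemma mollify_eq (ρ u : Euc N → ℝ) (x : Euc N) : mollify ρ u x = ∫ z, ρ z * u (z + x) := by
  rw [mollify, ← integral_add_right_eq_self _ x]
  simp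

lemma integrable_mollify {ρ u : Euc N → ℝ} {M : ℝ} (hρ : Integrable ρ) (hu : BddMeas M u)
    (x : Euc N) : Integrable fun y => ρ (y - x) * u y :=
  (hρ.comp_sub_right x).mul_bdd (c := M) hu.1.aestronglyMeasurable (Eventually.of_forall hu.2)

lemma abs_mollify_le {ρ u : Euc N → ℝ} {M : ℝ} (hρ : Integrable ρ) (h0 : ∀ x, 0 ≤ ρ x)
    (h1 : ∫ x, ρ x = 1) (hu : BddMeas M u) (x : Euc N) : |mollify ρ u x| ≤ M := by
  have hi : Integrable fun y => ρ (y - x) * M := (hρ.comp_sub_right x).mul_const M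
  have := norm_integral_le_of_norm_le hi (f := fun y => ρ (y - x) * u y)
    (Eventually.of_forall fun y => by
      rw [norm_mul, Real.norm_of_nonneg (h0 _)]
      exact mul_le_mul_of_nonneg_left (hu.2 y) (h0 _))
  rwa [integral_mul_const, integral_sub_right_eq_self, h1, one_mul] at this

lemma abs_mollify_sub_le {ρ u : Euc N → ℝ} {M : ℝ} (hρ : Integrable ρ) (hu : BddMeas M u)
    (x x' : Euc N) :
    |mollify ρ u x - mollify ρ u x'| ≤ M * ∫ y, |ρ (y + (x' - x)) - ρ y| := by
  have hi : Integrable fun y => |ρ (y - x) - ρ (y - x')| :=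
    ((hρ.comp_sub_right x).sub (hρ.comp_sub_right x')).abs
  rw [mollify, mollify, ← integral_sub (integrable_mollify hρ hu x) (integrable_mollify hρ hu x')]
  have := norm_integral_le_of_norm_le (hi.const_mul M)
    (f := fun y => ρ (y - x) * u y - ρ (y - x') * u y)
    (Eventually.of_forall fun y => by
      rw [← sub_mul, norm_mul, mul_comm]
      exact mul_le_mul_of_nonneg_right (hu.2 y) (norm_nonneg _))
  refine this.trans_eq ?_
  rw [integral_const_mul, ← integral_add_right_eq_self _ x']
  congr 2
  funext y
  congr 3 <;> abel

lemma tendsto_integral_shift {f : Euc N → ℝ} (hf : Integrable f) :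
    Tendsto (fun y : Euc N => ∫ x, |f (x + y) - f x|) (𝓝 0) (𝓝 0) := by
  have := (ENNReal.tendsto_toReal ENNReal.zero_ne_top).comp (tendsto_lintegral_shift hf)
  exact this.congr fun y => (integral_eq_lintegral_of_nonneg_ae
    (Eventually.of_forall fun _ => abs_nonneg _)
    ((hf.comp_add_right y).sub hf).abs.aestronglyMeasurable).symm

lemma continuous_mollify {ρ u : Euc N → ℝ} {M : ℝ} (hρ : Integrable ρ) (hu : BddMeas M u) :
    Continuous (mollify ρ u) := by
  rw [continuous_iff_continuousAt]
  intro x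
  rw [ContinuousAt, tendsto_iff_norm_sub_tendsto_zero]
  have h : Tendsto (fun x' => x - x') (𝓝 x) (𝓝 0) := by
    have : Continuous fun x' => x - x' := by fun_prop
    simpa using this.tendsto x
  have h2 := ((tendsto_integral_shift hρ).comp h).const_mul M
  rw [mul_zero] at h2
  exact squeeze_zero (fun _ => norm_nonneg _) (fun x' => abs_mollify_sub_le hρ hu x' x) h2

lemma lintegral_mollify_sub_le {ρ u : Euc N → ℝ} {M r ε : ℝ} (hρm : Measurable ρ)
    (hρ : Integrable ρ) (h0 : ∀ x, 0 ≤ ρ x) (h1 : ∫ x, ρ x = 1)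
    (hr : ∀ x, r ≤ ‖x‖ → ρ x = 0) (hu : BddMeas M u)
    (hs : ∀ y, ‖y‖ < r → ∫⁻ x, ENNReal.ofReal |u (x + y) - u x| ≤ ENNReal.ofReal ε) :
    ∫⁻ x, ENNReal.ofReal |mollify ρ u x - u x| ≤ ENNReal.ofReal ε := by
  have hum := hu.1
  have pt : ∀ x, ENNReal.ofReal |mollify ρ u x - u x| ≤
      ∫⁻ z, ENNReal.ofReal (ρ z) * ENNReal.ofReal |u (x + z) - u x| := by
    intro x
    have e : mollify ρ u x - u x = ∫ z, ρ z * (u (x + z) - u x) := by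
      have i1 : Integrable fun z => ρ z * u (x + z) :=
        hρ.mul_bdd (c := M) (hum.comp (measurable_const_add x)).aestronglyMeasurable
          (Eventually.of_forall fun z => hu.2 _)
      have i2 : Integrable fun z => ρ z * u x := hρ.mul_const _
      simp_rw [mul_sub]
      rw [integral_sub i1 i2, integral_mul_const, h1, one_mul, mollify_eq]
      simp_rw [add_comm x]
    rw [e]
    refine (ofReal_abs_integral_le _).trans_eq (lintegral_congr fun z => ?_)
    rw [abs_mul, abs_of_nonneg (h0 z), ENNReal.ofReal_mul (h0 z)]
  calc ∫⁻ x, ENNReal.ofReal |mollify ρ u x - u x|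
      ≤ ∫⁻ x, ∫⁻ z, ENNReal.ofReal (ρ z) * ENNReal.ofReal |u (x + z) - u x| := lintegral_mono pt
    _ = ∫⁻ z, ∫⁻ x, ENNReal.ofReal (ρ z) * ENNReal.ofReal |u (x + z) - u x| :=
        lintegral_lintegral_swap (by unfold Function.uncurry; fun_prop)
    _ ≤ ∫⁻ z, ENNReal.ofReal (ρ z) * ENNReal.ofReal ε := by
        refine lintegral_mono fun z => ?_
        simp only
        rw [lintegral_const_mul _ (by fun_prop)]
        rcases lt_or_ge ‖z‖ r with hz | hz
        · exact mul_le_mul_right (hs z hz) _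
        · simp [hr z hz]
    _ = ENNReal.ofReal ε := by
        rw [lintegral_mul_const _ (by fun_prop), ← ofReal_integral_eq_lintegral_ofReal hρ
          (Eventually.of_forall h0), h1]
        simp

end

noncomputable section

variable {N : ℕ}

/-- A bounded family of time-dependent functions which is equicontinuous in `L¹` under space
translations, and weakly equicontinuous in time up to the errors `τ n`. -/
structure EquiFamily (w : ℕ → ℝ → Euc N → ℝ) (τ : ℕ → ℝ) (M : ℝ) : Prop where
  bdd : ∀ n t, BddMeas M (w n t)
  tau : Tendsto τ atTop (𝓝 0)
  shift : ∀ ε > 0, ∃ r > 0, ∀ n t y, ‖y‖ < r →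
    ∫⁻ x, ENNReal.ofReal |w n t (x + y) - w n t x| ≤ ENNReal.ofReal ε
  time : ∀ ρ, IsTestFn ρ → ∃ C, 0 ≤ C ∧ ∀ n s t x,
    |mollify ρ (w n t) x - mollify ρ (w n s) x| ≤ C * (|t - s| + τ n)

namespace EquiFamily

variable {w : ℕ → ℝ → Euc N → ℝ} {τ : ℕ → ℝ} {M : ℝ}

lemma exists_kernel (h : EquiFamily w τ M) {ε : ℝ} (hε : 0 < ε) :
    ∃ ρ : Euc N → ℝ, IsTestFn ρ ∧ (∀ n t, BddMeas M (mollify ρ (w n t))) ∧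
      ∀ n t R, ballDist R (mollify ρ (w n t)) (w n t) ≤ ε := by
  obtain ⟨r, hr, hs⟩ := h.shift ε hε
  obtain ⟨ρ, hρ, h0, h1, hr'⟩ := exists_mollifier (N := N) hr
  have hb : ∀ n t, BddMeas M (mollify ρ (w n t)) := fun n t =>
    ⟨(continuous_mollify hρ.integrable (h.bdd n t)).measurable,
      abs_mollify_le hρ.integrable h0 h1 (h.bdd n t)⟩
  refine ⟨ρ, hρ, hb, fun n t R => ?_⟩
  exact ballDist_le_of_lintegral (hb n t).1 (h.bdd n t).1 hε.le
    (lintegral_mollify_sub_le hρ.1.continuous.measurable hρ.integrable h0 h1 hr' (h.bdd n t)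
      (hs n t)) R

lemma equicontinuous (h : EquiFamily w τ M) (R : ℝ) {ε : ℝ} (hε : 0 < ε) :
    ∃ δ > 0, ∀ n s t, |t - s| + τ n < δ → ballDist R (w n t) (w n s) ≤ ε := by
  obtain ⟨ρ, hρ, hb, hd⟩ := h.exists_kernel (ε := ε / 3) (by positivity)
  obtain ⟨C, hC, ht⟩ := h.time ρ hρ
  set V := volume.real (Metric.closedBall (0 : Euc N) R) with hV
  have hV0 : 0 ≤ V := measureReal_nonneg
  refine ⟨ε / 3 / (C * V + 1), by positivity, fun n s t hst => ?_⟩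
  have h1 := ballDist_triangle (h.bdd n t) (hb n t) (h.bdd n s) R
  have h2 := ballDist_triangle (hb n t) (hb n s) (h.bdd n s) R
  have h3 := ballDist_le_of_forall (R := R) fun x _ => ht n s t x
  have h4 := hd n t R
  rw [ballDist_comm] at h4
  have h5 := hd n s R
  have h6 : C * (|t - s| + τ n) * V ≤ ε / 3 := by
    rw [lt_div_iff₀ (by positivity)] at hst
    rcases le_or_gt 0 (|t - s| + τ n) with h0 | h0
    · nlinarith
    · have : C * V * (|t - s| + τ n) ≤ 0 :=
        mul_nonpos_of_nonneg_of_nonpos (by positivity) h0.le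
      linarith
  linarith

lemma tendsto_ballDist_of_pointwise (h : EquiFamily w τ M) {ρ : Euc N → ℝ} (hρ : IsTestFn ρ)
    {l : Filter ℕ} {t : ℝ} {v : Euc N → ℝ}
    (hv : ∀ x, Tendsto (fun n => mollify ρ (w n t) x) l (𝓝 (v x))) (R : ℝ) :
    Tendsto (fun n => ballDist R (mollify ρ (w n t)) v) l (𝓝 0) := by
  have heq : Equicontinuous fun n => mollify ρ (w n t) := by
    intro x
    rw [Metric.equicontinuousAt_iff_right]
    intro ε hε
    have hc : Tendsto (fun x' => x' - x) (𝓝 x) (𝓝 0) := by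
      have : Continuous fun x' => x' - x := by fun_prop
      simpa using this.tendsto x
    have h2 := ((tendsto_integral_shift hρ.integrable).comp hc).const_mul M
    rw [mul_zero] at h2
    filter_upwards [h2.eventually_lt_const hε] with x' hx' n
    exact (abs_mollify_sub_le hρ.integrable (h.bdd n t) x x').trans_lt hx'
  have hun : TendstoUniformlyOn (fun n => mollify ρ (w n t)) v l (Metric.closedBall 0 R) := by
    have := (EquicontinuousOn.tendsto_uniformOnFun_iff_pi (𝔖 := {K : Set (Euc N) | IsCompact K})
      (F := fun n => mollify ρ (w n t)) (fun K hK => hK)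
      (by
        refine sUnion_eq_univ_iff.2 fun x => ⟨{x}, isCompact_singleton, rfl⟩)
      (fun K _ => heq.equicontinuousOn K) l v).2 (tendsto_pi_nhds.2 hv)
    exact UniformOnFun.tendsto_iff_tendstoUniformlyOn.1 this _ (isCompact_closedBall 0 R)
  rw [Metric.tendsto_nhds]
  intro ε hε
  set V := volume.real (Metric.closedBall (0 : Euc N) R) with hV
  have hV0 : 0 ≤ V := measureReal_nonneg
  filter_upwards [Metric.tendstoUniformlyOn_iff.1 hun (ε / (V + 1)) (by positivity)] with n hn
  have h3 := ballDist_le_of_forall (f := mollify ρ (w n t)) (g := v) (R := R)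
    (ε := ε / (V + 1)) fun x hx => by
      have := (hn x hx).le
      rwa [dist_comm, Real.dist_eq] at this
  rw [Real.dist_eq, sub_zero, abs_of_nonneg (ballDist_nonneg _ _ _)]
  refine h3.trans_lt ?_
  rw [div_mul_eq_mul_div, div_lt_iff₀ (by positivity)]
  nlinarith

end EquiFamily

lemma exists_tendsto_ultrafilter (l : Ultrafilter ℕ) {a : ℕ → ℝ} {M : ℝ} (h : ∀ n, |a n| ≤ M) :
    ∃ b, Tendsto a l (𝓝 b) := by
  obtain ⟨b, -, hb⟩ := (isCompact_Icc (a := -M) (b := M)).ultrafilter_le_nhds (l.map a)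
    (by
      rw [le_principal_iff]
      exact mem_map.2 (univ_mem' fun n => abs_le.1 (h n)))
  exact ⟨b, hb⟩

lemma abs_limsup_le {a : ℕ → ℝ} {M : ℝ} (h : ∀ n, |a n| ≤ M) : |limsup a atTop| ≤ M := by
  have hu : IsBoundedUnder (· ≤ ·) atTop a := isBoundedUnder_of ⟨M, fun n => (abs_le.1 (h n)).2⟩
  have hl : IsBoundedUnder (· ≥ ·) atTop a := isBoundedUnder_of ⟨-M, fun n => (abs_le.1 (h n)).1⟩
  rw [abs_le]
  constructor
  · exact le_limsup_of_frequently_le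
      (Frequently.of_forall fun n => (abs_le.1 (h n)).1) hu
  · exact limsup_le_of_le hl.isCoboundedUnder_le
      (Eventually.of_forall fun n => (abs_le.1 (h n)).2)

/-- A sequence which is Cauchy in `L¹_loc` with geometric rate converges to its `limsup`. -/
lemma tendsto_ballDist_limsup {v : ℕ → Euc N → ℝ} {M : ℝ} (hb : ∀ j, BddMeas M (v j))
    (hc : ∀ R i j, ballDist R (v i) (v j) ≤ (1 / 2) ^ i + (1 / 2) ^ j) (R : ℝ) :
    Tendsto (fun j => ballDist R (v j) fun x => limsup (fun j => v j x) atTop) atTop (𝓝 0) := by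
  set m := (volume : Measure (Euc N)).restrict (Metric.closedBall 0 R) with hm
  have hfin : IsFiniteMeasure m :=
    ⟨by simpa [hm] using (isCompact_closedBall (0 : Euc N) R).measure_lt_top⟩
  have hae : ∀ᵐ x ∂m, ∃ l, Tendsto (fun j => v j x) atTop (𝓝 l) := by
    refine Lp.ae_tendsto_of_cauchy_eLpNorm (p := 1)
      (B := fun n => ENNReal.ofReal (3 * (1 / 2) ^ n))
      (fun n => (hb n).1.aestronglyMeasurable) le_rfl ?_ ?_
    · rw [← ENNReal.ofReal_tsum_of_nonneg (fun n => by positivity)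
        (summable_geometric_two.mul_left 3)]
      exact ENNReal.ofReal_ne_top
    · intro K i j hi hj
      have hint : Integrable (fun x => v i x - v j x) m :=
        ((hb i).integrableOn R).sub ((hb j).integrableOn R)
      rw [eLpNorm_one_eq_lintegral_enorm]
      have e := ofReal_integral_norm_eq_lintegral_enorm hint
      simp only [Pi.sub_apply]
      rw [← e, ENNReal.ofReal_lt_ofReal_iff (by positivity)]
      have h1 := hc R i j
      have h2 : ((1 : ℝ) / 2) ^ i ≤ (1 / 2) ^ K :=
        pow_le_pow_of_le_one (by norm_num) (by norm_num) hi
      have h3 : ((1 : ℝ) / 2) ^ j ≤ (1 / 2) ^ K :=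
        pow_le_pow_of_le_one (by norm_num) (by norm_num) hj
      have h4 : (0 : ℝ) < (1 / 2) ^ K := by positivity
      simp only [Real.norm_eq_abs]
      unfold ballDist at h1
      linarith
  have hlim : Measurable fun x => limsup (fun j => v j x) atTop :=
    Measurable.limsup fun j => (hb j).1
  have hz : (0 : ℝ) = ∫ _, (0 : ℝ) ∂m := by simp
  rw [hz]
  refine tendsto_integral_of_dominated_convergence (fun _ => M + M)
    (fun j => ((hb j).1.sub hlim).abs.aestronglyMeasurable) (integrable_const _)
    (fun j => Eventually.of_forall fun x => ?_) ?_
  · rw [Real.norm_eq_abs, abs_abs]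
    exact (abs_sub _ _).trans (add_le_add ((hb j).2 x) (abs_limsup_le fun j => (hb j).2 x))
  · filter_upwards [hae] with x ⟨l, hl⟩
    rw [hl.limsup_eq]
    simpa using (hl.sub_const l).abs

namespace EquiFamily

variable {w : ℕ → ℝ → Euc N → ℝ} {τ : ℕ → ℝ} {M : ℝ}

theorem exists_limit (h : EquiFamily w τ M) (l : Ultrafilter ℕ) (hl : (l : Filter ℕ) ≤ atTop) :
    ∃ u : Euc N → ℝ → ℝ, Measurable (Function.uncurry u) ∧ (∀ x t, |u x t| ≤ M) ∧
      ∀ t R, Tendsto (fun n => ballDist R (w n t) fun x => u x t) l (𝓝 0) := by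
  choose ρ hρ hb hd using fun j : ℕ => h.exists_kernel (ε := (1 / 2) ^ j) (by positivity)
  choose v hv using fun (j : ℕ) (t : ℝ) (x : Euc N) =>
    exists_tendsto_ultrafilter l (a := fun n => mollify (ρ j) (w n t) x)
      fun n => (hb j n t).2 x
  have hvM : ∀ j t x, |v j t x| ≤ M := fun j t x =>
    le_of_tendsto (hv j t x).abs (Eventually.of_forall fun n => (hb j n t).2 x)
  have hcont : ∀ j, Continuous fun p : Euc N × ℝ => v j p.2 p.1 := by
    intro j
    obtain ⟨C, hC, ht⟩ := h.time (ρ j) (hρ j)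
    have est : ∀ p q : Euc N × ℝ, |v j p.2 p.1 - v j q.2 q.1| ≤
        M * (∫ y, |ρ j (y + (q.1 - p.1)) - ρ j y|) + C * |p.2 - q.2| := by
      intro p q
      have hτ : Tendsto (fun n => M * (∫ y, |ρ j (y + (q.1 - p.1)) - ρ j y|) +
          C * (|p.2 - q.2| + τ n)) l
          (𝓝 (M * (∫ y, |ρ j (y + (q.1 - p.1)) - ρ j y|) + C * (|p.2 - q.2| + 0))) :=
        (((h.tau.mono_left hl).const_add _).const_mul _).const_add _
      rw [add_zero] at hτ
      refine le_of_tendsto_of_tendsto' ((hv j p.2 p.1).sub (hv j q.2 q.1)).abs hτ fun n => ?_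
      refine (abs_sub_le _ (mollify (ρ j) (w n p.2) q.1) _).trans (add_le_add ?_ (ht n _ _ _))
      exact abs_mollify_sub_le (hρ j).integrable (h.bdd n p.2) _ _
    rw [continuous_iff_continuousAt]
    intro q
    rw [ContinuousAt, tendsto_iff_norm_sub_tendsto_zero]
    have hc : Tendsto (fun p : Euc N × ℝ => q.1 - p.1) (𝓝 q) (𝓝 0) := by
      have : Continuous fun p : Euc N × ℝ => q.1 - p.1 := by fun_prop
      simpa using this.tendsto q
    have hc2 : Tendsto (fun p : Euc N × ℝ => C * |p.2 - q.2|) (𝓝 q) (𝓝 0) := by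
      have : Continuous fun p : Euc N × ℝ => C * |p.2 - q.2| := by fun_prop
      simpa using this.tendsto q
    have h2 := (((tendsto_integral_shift (hρ j).integrable).comp hc).const_mul M).add hc2
    rw [mul_zero, add_zero] at h2
    exact squeeze_zero (fun _ => norm_nonneg _) (fun p => est p q) h2
  have hvb : ∀ j t, BddMeas M (v j t) := fun j t =>
    ⟨((hcont j).comp (Continuous.prodMk_left t)).measurable, hvM j t⟩
  have hconv : ∀ j t R, Tendsto (fun n => ballDist R (mollify (ρ j) (w n t)) (v j t)) l (𝓝 0) :=
    fun j t R => h.tendsto_ballDist_of_pointwise (hρ j) (hv j t) R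
  have hcau : ∀ t R i j, ballDist R (v i t) (v j t) ≤ (1 / 2) ^ i + (1 / 2) ^ j := by
    intro t R i j
    have lim := ((hconv i t R).add (hconv j t R)).add_const (((1 : ℝ) / 2) ^ i + (1 / 2) ^ j)
    rw [add_zero, zero_add] at lim
    refine ge_of_tendsto lim (Eventually.of_forall fun n => ?_)
    have t1 := ballDist_triangle (hvb i t) (hb i n t) (hvb j t) R
    have t2 := ballDist_triangle (hb i n t) (h.bdd n t) (hvb j t) R
    have t3 := ballDist_triangle (h.bdd n t) (hb j n t) (hvb j t) R
    have d1 := hd i n t R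
    have d2 := hd j n t R
    rw [ballDist_comm] at d2
    rw [ballDist_comm R (v i t) (mollify (ρ i) (w n t))] at t1
    linarith
  have hub : ∀ t, BddMeas M fun x => limsup (fun j => v j t x) atTop := fun t =>
    ⟨Measurable.limsup fun j => (hvb j t).1, fun x => abs_limsup_le fun j => hvM j t x⟩
  refine ⟨fun x t => limsup (fun j => v j t x) atTop,
    Measurable.limsup fun j => (hcont j).measurable, fun x t => (hub t).2 x, fun t R => ?_⟩
  have hlim := tendsto_ballDist_limsup (hvb · t) (fun R i j => hcau t R i j) R
  have hgeo : Tendsto (fun j : ℕ => ((1 : ℝ) / 2) ^ j) atTop (𝓝 0) :=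
    tendsto_pow_atTop_nhds_zero_of_lt_one (by norm_num) (by norm_num)
  rw [Metric.tendsto_nhds]
  intro ε hε
  obtain ⟨j, hj1, hj2⟩ := ((hlim.eventually_lt_const (show 0 < ε / 3 by positivity)).and
    (hgeo.eventually_lt_const (show 0 < ε / 3 by positivity))).exists
  filter_upwards [(hconv j t R).eventually_lt_const (show 0 < ε / 3 by positivity)] with n hn
  rw [Real.dist_eq, sub_zero, abs_of_nonneg (ballDist_nonneg _ _ _)]
  have t1 := ballDist_triangle (h.bdd n t) (hb j n t) (hub t) R
  have t2 := ballDist_triangle (hb j n t) (hvb j t) (hub t) R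
  have d1 := hd j n t R
  rw [ballDist_comm] at d1
  linarith

end EquiFamily

end

noncomputable section

variable {N : ℕ}

lemma exists_taylor_bound {V : Type*} [NormedAddCommGroup V] [NormedSpace ℝ V] {f : V → ℝ}
    (hf : ContDiff ℝ 2 f) (hs : HasCompactSupport f) :
    ∃ B, 0 ≤ B ∧ (∀ x, |f x| ≤ B) ∧ ∀ x z, |f (x + z) - f x - fderiv ℝ f x z| ≤ B * ‖z‖ ^ 2 := by
  have hf1 : ContDiff ℝ 1 (fderiv ℝ f) := hf.fderiv_right (by norm_num)
  obtain ⟨L, hL⟩ := hf1.lipschitzWith_of_hasCompactSupport (hs.fderiv ℝ) one_ne_zero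
  obtain ⟨C, hC⟩ := hs.exists_bound_of_continuous hf.continuous
  refine ⟨max C L, le_max_of_le_right L.2, fun x => (hC x).trans (le_max_left _ _), fun x z => ?_⟩
  have key := (convex_closedBall x ‖z‖).norm_image_sub_le_of_norm_fderiv_le' (f := f)
    (φ := fderiv ℝ f x) (C := L * ‖z‖) (x := x) (y := x + z)
    (fun y _ => (hf.differentiable (by norm_num)) y)
    (fun y hy => by
      refine (hL.norm_sub_le y x).trans ?_
      have : ‖y - x‖ ≤ ‖z‖ := by simpa [dist_eq_norm] using hy
      gcongr)
    (by simp) (by simp)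
  rw [add_sub_cancel_left] at key
  refine key.trans ?_
  have h2 : (L : ℝ) ≤ max C L := le_max_right _ _
  have h3 : 0 ≤ ‖z‖ * ‖z‖ := by positivity
  nlinarith

/-- Centred second difference of `ψ` with increment `z`. -/
def secondDiff (ψ : Euc N → ℝ) (z x : Euc N) : ℝ := ψ (x + z) + ψ (x - z) - 2 * ψ x

/-- The truncation `min(|z|², 1)` appearing in the definition of Lévy measures. -/
def levyWeight (z : Euc N) : ℝ := min (‖z‖ ^ 2) 1

lemma levyWeight_nonneg (z : Euc N) : 0 ≤ levyWeight z := le_min (by positivity) zero_le_one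

lemma measurable_levyWeight : Measurable (levyWeight (N := N)) := by
  unfold levyWeight; fun_prop

/-- The `L¹` norms of the second differences of `ψ` are controlled by `K min(|z|², 1)`. -/
structure SdiffBound (ψ : Euc N → ℝ) (K : ℝ) : Prop where
  meas : Measurable ψ
  bdd : ∃ B, ∀ x, |ψ x| ≤ B
  nonneg : 0 ≤ K
  le : ∀ z, ∫⁻ x, ENNReal.ofReal |secondDiff ψ z x| ≤ ENNReal.ofReal (K * levyWeight z)

lemma lintegral_abs_le_of_support {f : Euc N → ℝ} {c R : ℝ} (hc0 : 0 ≤ c) (hc : ∀ x, |f x| ≤ c)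
    (hf : ∀ x, R < ‖x‖ → f x = 0) :
    ∫⁻ x, ENNReal.ofReal |f x| ≤
      ENNReal.ofReal (c * volume.real (Metric.closedBall (0 : Euc N) R)) := by
  calc ∫⁻ x, ENNReal.ofReal |f x|
      ≤ ∫⁻ x, (Metric.closedBall (0 : Euc N) R).indicator (fun _ => ENNReal.ofReal c) x := by
        refine lintegral_mono fun x => ?_
        by_cases hx : x ∈ Metric.closedBall (0 : Euc N) R
        · rw [indicator_of_mem hx]
          exact ENNReal.ofReal_le_ofReal (hc x)
        · rw [hf x (by simpa using hx)]
          simp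
    _ = _ := by
        rw [lintegral_indicator_const Metric.isClosed_closedBall.measurableSet,
          ENNReal.ofReal_mul hc0, ofReal_measureReal (isCompact_closedBall _ _).measure_ne_top]

lemma SdiffBound.of_support {ψ : Euc N → ℝ} (hm : Measurable ψ) {B R : ℝ} (hB : 0 ≤ B)
    (hb : ∀ x, |ψ x| ≤ B) (hs : ∀ x z, |secondDiff ψ z x| ≤ B * ‖z‖ ^ 2)
    (hR : ∀ x, R < ‖x‖ → ψ x = 0) :
    SdiffBound ψ (4 * B * volume.real (Metric.closedBall (0 : Euc N) (R + 1))) := by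
  set V := volume.real (Metric.closedBall (0 : Euc N) (R + 1)) with hV
  have hV0 : 0 ≤ V := measureReal_nonneg
  refine ⟨hm, ⟨B, hb⟩, by positivity, fun z => ?_⟩
  rcases le_or_gt ‖z‖ 1 with hz | hz
  · refine (lintegral_abs_le_of_support (c := B * ‖z‖ ^ 2) (R := R + 1) (by positivity) (hs · z)
      fun x hx => ?_).trans
      (ENNReal.ofReal_le_ofReal ?_)
    · have h1 : R < ‖x + z‖ := by
        have := norm_sub_le (x + z) z
        rw [add_sub_cancel_right] at this
        linarith
      have h2 : R < ‖x - z‖ := by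
        have := norm_add_le (x - z) z
        rw [sub_add_cancel] at this
        linarith
      simp [secondDiff, hR _ h1, hR _ h2, hR x (by linarith)]
    · rw [levyWeight, min_eq_left (by nlinarith [norm_nonneg z])]
      have : 0 ≤ B * V * ‖z‖ ^ 2 := by positivity
      nlinarith
  · have h1 := lintegral_abs_le_of_support (R := R + 1) hB hb fun x hx => hR x (by linarith)
    have hw : levyWeight z = 1 := min_eq_right (by nlinarith)
    calc ∫⁻ x, ENNReal.ofReal |secondDiff ψ z x|
        ≤ ∫⁻ x, (ENNReal.ofReal |ψ (x + z)| + ENNReal.ofReal |ψ (x - z)| +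
            ENNReal.ofReal (2 * |ψ x|)) := by
          refine lintegral_mono fun x => ?_
          rw [← ENNReal.ofReal_add (by positivity) (by positivity),
            ← ENNReal.ofReal_add (by positivity) (by positivity)]
          refine ENNReal.ofReal_le_ofReal ?_
          refine (abs_sub _ _).trans ?_
          rw [abs_mul, abs_two]
          gcongr
          exact abs_add_le _ _
      _ = 4 * ∫⁻ x, ENNReal.ofReal |ψ x| := by
          rw [lintegral_add_left (by fun_prop), lintegral_add_left (by fun_prop),
            lintegral_add_right_eq_self (fun x => ENNReal.ofReal |ψ x|),
            lintegral_sub_right_eq_self (fun x => ENNReal.ofReal |ψ x|)]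
          simp only [ENNReal.ofReal_mul zero_le_two, ENNReal.ofReal_ofNat]
          rw [lintegral_const_mul _ (by fun_prop)]
          ring
      _ ≤ ENNReal.ofReal (4 * B * V * levyWeight z) := by
          rw [hw, mul_one, mul_assoc, ENNReal.ofReal_mul (by norm_num)]
          simp only [ENNReal.ofReal_ofNat]
          gcongr

lemma abs_sdiff_le {V : Type*} [NormedAddCommGroup V] [NormedSpace ℝ V] {f : V → ℝ} {B : ℝ}
    (h : ∀ x z, |f (x + z) - f x - fderiv ℝ f x z| ≤ B * ‖z‖ ^ 2) (x z : V) :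
    |f (x + z) + f (x - z) - 2 * f x| ≤ 2 * B * ‖z‖ ^ 2 := by
  have h1 := abs_le.1 (h x z)
  have h2 := abs_le.1 (h x (-z))
  rw [map_neg, norm_neg, ← sub_eq_add_neg] at h2
  rw [abs_le]
  constructor <;> linarith

lemma exists_norm_bound_support {V : Type*} [NormedAddCommGroup V] {f : V → ℝ}
    (hs : HasCompactSupport f) : ∃ R, ∀ x, R < ‖x‖ → f x = 0 := by
  obtain ⟨R, hR⟩ := hs.isCompact.isBounded.exists_norm_le
  exact ⟨R, fun x hx => image_eq_zero_of_notMem_tsupport fun hx' => by linarith [hR x hx']⟩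

lemma IsSTTestFn.exists_sdiffBound {T : ℝ} {ψ : Euc N → ℝ → ℝ} (h : IsSTTestFn T ψ) :
    ∃ K, ∀ t, SdiffBound (fun x => ψ x t) K := by
  obtain ⟨B, hB, hb, ht⟩ := exists_taylor_bound
    (contDiff_infty.1 h.1 2) h.2.1
  obtain ⟨R, hR⟩ := exists_norm_bound_support h.2.1
  refine ⟨4 * (2 * B) * volume.real (Metric.closedBall (0 : Euc N) (R + 1)), fun t => ?_⟩
  refine SdiffBound.of_support ?_ (by positivity) (fun x => ?_) (fun x z => ?_) fun x hx => ?_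
  · exact (h.1.continuous.comp (Continuous.prodMk_left t)).measurable
  · have := hb (x, t)
    simp only [Function.uncurry] at this
    linarith
  · simpa [secondDiff, Function.uncurry, Prod.norm_def] using abs_sdiff_le ht (x, t) (z, 0)
  · exact hR (x, t) (hx.trans_le (norm_fst_le (x, t)))

lemma IsTestFn.exists_sdiffBound {ψ : Euc N → ℝ} (h : IsTestFn ψ) : ∃ K, SdiffBound ψ K := by
  obtain ⟨B, hB, hb, ht⟩ := exists_taylor_bound
    (contDiff_infty.1 h.1 2) h.2
  obtain ⟨R, hR⟩ := exists_norm_bound_support h.2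
  exact ⟨_, SdiffBound.of_support h.1.continuous.measurable (B := 2 * B) (by positivity)
    (fun x => by linarith [hb x]) (abs_sdiff_le ht) hR⟩

/-- Symmetrized form of the nonlocal operator. -/
def symOp (μ : Measure (Euc N)) (ψ : Euc N → ℝ) (x : Euc N) : ℝ :=
  (∫ z, secondDiff ψ z x ∂μ) / 2

lemma measurable_symOp {μ : Measure (Euc N)} [SFinite μ] {ψ : Euc N → ℝ} (hψ : Measurable ψ) :
    Measurable (symOp μ ψ) := by
  have h : StronglyMeasurable (Function.uncurry fun x z : Euc N => secondDiff ψ z x) := by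
    apply Measurable.stronglyMeasurable
    unfold Function.uncurry secondDiff
    fun_prop
  exact h.integral_prod_right.measurable.div_const 2

lemma SdiffBound.lintegral_symOp_le {ψ : Euc N → ℝ} {K : ℝ} (h : SdiffBound ψ K)
    (μ : Measure (Euc N)) [SFinite μ] :
    ∫⁻ x, ENNReal.ofReal |symOp μ ψ x| ≤
      ENNReal.ofReal K * ∫⁻ z, ENNReal.ofReal (levyWeight z) ∂μ := by
  have hψ := h.meas
  calc ∫⁻ x, ENNReal.ofReal |symOp μ ψ x|
      ≤ ∫⁻ x, ∫⁻ z, ENNReal.ofReal |secondDiff ψ z x| ∂μ := by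
        refine lintegral_mono fun x => ?_
        refine le_trans (ENNReal.ofReal_le_ofReal ?_) (ofReal_abs_integral_le _)
        rw [symOp, abs_div, abs_two]
        linarith [abs_nonneg (∫ z, secondDiff ψ z x ∂μ)]
    _ = ∫⁻ z, ∫⁻ x, ENNReal.ofReal |secondDiff ψ z x| ∂volume ∂μ :=
        lintegral_lintegral_swap (by unfold Function.uncurry secondDiff; fun_prop)
    _ ≤ ∫⁻ z, ENNReal.ofReal K * ENNReal.ofReal (levyWeight z) ∂μ := by
        refine lintegral_mono fun z => ?_
        rw [← ENNReal.ofReal_mul h.nonneg]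
        exact h.le z
    _ = _ := lintegral_const_mul _ measurable_levyWeight.ennreal_ofReal

lemma integral_symm {μ : Measure (Euc N)} (hsymm : μ.map (fun z => -z) = μ) (f : Euc N → ℝ) :
    ∫ z, f (-z) ∂μ = ∫ z, f z ∂μ := by
  conv_rhs => rw [← hsymm]
  exact ((MeasurableEquiv.neg (Euc N)).measurableEmbedding.integral_map f).symm

lemma integrable_symm {μ : Measure (Euc N)} (hsymm : μ.map (fun z => -z) = μ) {f : Euc N → ℝ}
    (hf : Integrable f μ) : Integrable (fun z => f (-z)) μ := by
  have h : MeasurePreserving (fun z : Euc N => -z) μ μ := ⟨by fun_prop, hsymm⟩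
  exact h.integrable_comp_of_integrable hf

lemma integral_eq_half {μ : Measure (Euc N)} (hsymm : μ.map (fun z => -z) = μ) {f : Euc N → ℝ}
    (hf : Integrable f μ) : ∫ z, f z ∂μ = (∫ z, (f z + f (-z)) ∂μ) / 2 := by
  rw [integral_add hf (integrable_symm hsymm hf), integral_symm hsymm]
  ring

lemma diffOp_eq_symOp {ν : Measure (Euc N)} [IsFiniteMeasure ν]
    (hsymm : ν.map (fun z => -z) = ν) {ψ : Euc N → ℝ} (hm : Measurable ψ)
    (hb : ∃ B, ∀ x, |ψ x| ≤ B) : diffOp ν ψ = symOp ν ψ := by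
  obtain ⟨B, hB⟩ := hb
  funext x
  have hi : Integrable (fun z => ψ (x + z) - ψ x) ν :=
    integrable_of_bound (C := B + B) (by fun_prop)
      fun z => (abs_sub _ _).trans (add_le_add (hB _) (hB _))
  rw [diffOp, integral_eq_half hsymm hi, symOp]
  congr 2
  funext z
  rw [secondDiff, ← sub_eq_add_neg]
  ring

lemma IsLevyMeasure.integrable_levyWeight {μ : Measure (Euc N)} (h : IsLevyMeasure μ) :
    Integrable levyWeight μ := by
  refine ⟨measurable_levyWeight.aestronglyMeasurable, ?_⟩
  rw [hasFiniteIntegral_iff_ofReal (Eventually.of_forall levyWeight_nonneg)]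
  exact lt_top_iff_ne_top.2 h.2.2

lemma Lop_eq_symOp {μ : Measure (Euc N)} (h : IsLevyMeasure μ) {ψ : Euc N → ℝ}
    (hψ : IsTestFn ψ) : Lop μ ψ = symOp μ ψ := by
  obtain ⟨B, hB, hb, ht⟩ := exists_taylor_bound
    (contDiff_infty.1 hψ.1 2) hψ.2
  funext x
  have hc := hψ.1.continuous.measurable
  have hi : Integrable
      (fun z => ψ (x + z) - ψ x - (if ‖z‖ ≤ 1 then fderiv ℝ ψ x z else 0)) μ := by
    refine (h.integrable_levyWeight.const_mul (2 * B)).mono' ?_ (Eventually.of_forall fun z => ?_)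
    · refine Measurable.aestronglyMeasurable (Measurable.sub (by fun_prop) ?_)
      exact Measurable.ite (measurableSet_le (by fun_prop) (by fun_prop)) (by fun_prop)
        (by fun_prop)
    · rw [Real.norm_eq_abs, levyWeight]
      split_ifs with hz
      · rw [min_eq_left (by nlinarith [norm_nonneg z])]
        have : 0 ≤ B * ‖z‖ ^ 2 := by positivity
        linarith [ht x z]
      · rw [min_eq_right (by nlinarith), sub_zero]
        linarith [abs_sub (ψ (x + z)) (ψ x), hb x, hb (x + z)]
  rw [Lop, integral_eq_half h.2.1 hi, symOp]
  congr 2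
  funext z
  rw [secondDiff, ← sub_eq_add_neg, norm_neg, map_neg]
  split_ifs <;> ring

lemma IsLevyMeasure.measure_lt_top {μ : Measure (Euc N)} (h : IsLevyMeasure μ) {r : ℝ}
    (hr : 0 < r) : μ {z | r < ‖z‖} < ⊤ := by
  refine (measure_mono fun z hz => ?_).trans_lt
    (h.integrable_levyWeight.measure_ge_lt_top (ε := min (r ^ 2) 1) (by positivity))
  have hz : r < ‖z‖ := hz
  exact min_le_min_right _ (pow_le_pow_left₀ hr.le hz.le 2)

lemma IsLevyMeasure.sigmaFinite {μ : Measure (Euc N)} (h : IsLevyMeasure μ) : SigmaFinite μ := by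
  refine ⟨⟨fun n => {z | z = 0 ∨ 1 / ((n : ℝ) + 1) < ‖z‖}, fun n => trivial, fun n => ?_, ?_⟩⟩
  · refine (measure_union_le {z | z = 0} {z | 1 / ((n : ℝ) + 1) < ‖z‖}).trans_lt ?_
    rw [show {z : Euc N | z = 0} = {0} from rfl, h.1, zero_add]
    exact h.measure_lt_top (by positivity)
  · refine eq_univ_of_forall fun z => mem_iUnion.2 ?_
    rcases eq_or_ne z 0 with hz | hz
    · exact ⟨0, Or.inl hz⟩
    · obtain ⟨n, hn⟩ := exists_nat_one_div_lt (norm_pos_iff.2 hz)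
      exact ⟨n, Or.inr hn⟩

lemma symOp_restrict_add {μ : Measure (Euc N)} (h : IsLevyMeasure μ) {ψ : Euc N → ℝ}
    (hψ : IsTestFn ψ) {s : Set (Euc N)} (hs : MeasurableSet s) (x : Euc N) :
    symOp μ ψ x = symOp (μ.restrict s) ψ x + symOp (μ.restrict sᶜ) ψ x := by
  obtain ⟨B, hB, hb, ht⟩ := exists_taylor_bound
    (contDiff_infty.1 hψ.1 2) hψ.2
  have hc := hψ.1.continuous
  have hi : Integrable (fun z => secondDiff ψ z x) μ := by
    refine (h.integrable_levyWeight.const_mul (4 * B)).mono'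
      (by unfold secondDiff; fun_prop) (Eventually.of_forall fun z => ?_)
    rw [Real.norm_eq_abs, levyWeight]
    rcases le_or_gt ‖z‖ 1 with hz | hz
    · rw [min_eq_left (by nlinarith [norm_nonneg z])]
      have : 0 ≤ B * ‖z‖ ^ 2 := by positivity
      have h2 := abs_sdiff_le ht x z
      rw [secondDiff]
      linarith
    · rw [min_eq_right (by nlinarith), secondDiff, abs_le]
      have h1 := abs_le.1 (hb (x + z))
      have h2 := abs_le.1 (hb (x - z))
      have h3 := abs_le.1 (hb x)
      constructor <;> linarith
  simp only [symOp]
  rw [← integral_add_compl hs hi]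
  ring

end

noncomputable section

variable {N : ℕ}

/-- The finite symmetric measures `ν n` generate operators approximating `A`, with uniform control
of the `L¹` norms. -/
structure OpApprox (ν : ℕ → Measure (Euc N)) (A : (Euc N → ℝ) → Euc N → ℝ) (Λ : ℝ) : Prop where
  finite : ∀ n, IsFiniteMeasure (ν n)
  symm : ∀ n, (ν n).map (fun z => -z) = ν n
  nonneg : 0 ≤ Λ
  bound : ∀ n ψ K, SdiffBound ψ K →
    ∫⁻ x, ENNReal.ofReal |diffOp (ν n) ψ x| ≤ ENNReal.ofReal (K * Λ)
  meas : ∀ ψ, IsTestFn ψ → Measurable (A ψ)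
  lim : ∀ ψ, IsTestFn ψ →
    Tendsto (fun n => ∫⁻ x, ENNReal.ofReal |diffOp (ν n) ψ x - A ψ x|) atTop (𝓝 0)

lemma OpApprox.lintegral_le {ν : ℕ → Measure (Euc N)} {A : (Euc N → ℝ) → Euc N → ℝ} {Λ : ℝ}
    (h : OpApprox ν A Λ) {ψ : Euc N → ℝ} (hψ : IsTestFn ψ) {K : ℝ} (hK : SdiffBound ψ K) :
    ∫⁻ x, ENNReal.ofReal |A ψ x| ≤ ENNReal.ofReal (K * Λ) := by
  have hA := h.meas ψ hψ
  have key : ∀ n, ∫⁻ x, ENNReal.ofReal |A ψ x| ≤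
      ENNReal.ofReal (K * Λ) + ∫⁻ x, ENNReal.ofReal |diffOp (ν n) ψ x - A ψ x| := by
    intro n
    have := h.finite n
    have hm : Measurable (diffOp (ν n) ψ) := measurable_diffOp hK.meas
    refine le_trans ?_ (add_le_add_left (h.bound n ψ K hK) _)
    rw [← lintegral_add_left (by fun_prop)]
    refine lintegral_mono fun x => ?_
    rw [← ENNReal.ofReal_add (abs_nonneg _) (abs_nonneg _)]
    refine ENNReal.ofReal_le_ofReal ?_
    have := abs_sub (diffOp (ν n) ψ x) (diffOp (ν n) ψ x - A ψ x)
    rwa [sub_sub_cancel] at this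
  refine ge_of_tendsto' (f := fun n => ENNReal.ofReal (K * Λ) +
    ∫⁻ x, ENNReal.ofReal |diffOp (ν n) ψ x - A ψ x|) (x := atTop) ?_ key
  simpa using (h.lim ψ hψ).const_add (ENNReal.ofReal (K * Λ))

lemma OpApprox.integrable {ν : ℕ → Measure (Euc N)} {A : (Euc N → ℝ) → Euc N → ℝ} {Λ : ℝ}
    (h : OpApprox ν A Λ) {ψ : Euc N → ℝ} (hψ : IsTestFn ψ) : Integrable (A ψ) := by
  obtain ⟨K, hK⟩ := hψ.exists_sdiffBound
  refine ⟨(h.meas ψ hψ).aestronglyMeasurable, ?_⟩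
  rw [hasFiniteIntegral_iff_enorm]
  simp only [Real.enorm_eq_ofReal_abs]
  exact (h.lintegral_le hψ hK).trans_lt ENNReal.ofReal_lt_top

/-- The discretization at scale `h` of the directional second derivative along `v`. -/
def pairMeasure (v : Euc N) (h : ℝ) : Measure (Euc N) :=
  ENNReal.ofReal ((h ^ 2)⁻¹) • (Measure.dirac (h • v) + Measure.dirac (-(h • v)))

lemma isFiniteMeasure_pairMeasure (v : Euc N) (h : ℝ) : IsFiniteMeasure (pairMeasure v h) :=
  Measure.smul_finite _ ENNReal.ofReal_ne_top

lemma map_neg_pairMeasure (v : Euc N) (h : ℝ) :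
    (pairMeasure v h).map (fun z => -z) = pairMeasure v h := by
  rw [pairMeasure, Measure.map_smul, Measure.map_add _ _ (by fun_prop), Measure.map_dirac,
    Measure.map_dirac, neg_neg, add_comm]

lemma symOp_pairMeasure (v : Euc N) (h : ℝ) (ψ : Euc N → ℝ) (x : Euc N) :
    symOp (pairMeasure v h) ψ x = (h ^ 2)⁻¹ * secondDiff ψ (h • v) x := by
  have : secondDiff ψ (-(h • v)) x = secondDiff ψ (h • v) x := by
    rw [secondDiff, secondDiff, sub_neg_eq_add, ← sub_eq_add_neg]
    ring
  rw [symOp, pairMeasure, integral_smul_measure, integral_add_measure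
    (integrable_dirac (by simp)) (integrable_dirac (by simp)),
    integral_dirac, integral_dirac, this, ENNReal.toReal_ofReal (by positivity), smul_eq_mul]
  ring

lemma lintegral_levyWeight_pairMeasure_le (v : Euc N) {h : ℝ} (hh : 0 < h) :
    ∫⁻ z, ENNReal.ofReal (levyWeight z) ∂(pairMeasure v h) ≤ ENNReal.ofReal (2 * ‖v‖ ^ 2) := by
  rw [pairMeasure, lintegral_smul_measure, lintegral_add_measure, lintegral_dirac, lintegral_dirac]
  have hw : ∀ z : Euc N, ‖z‖ = h * ‖v‖ → levyWeight z ≤ h ^ 2 * ‖v‖ ^ 2 := by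
    intro z hz
    rw [levyWeight, hz, mul_pow]
    exact min_le_left _ _
  have h1 := hw (h • v) (by rw [norm_smul, Real.norm_of_nonneg hh.le])
  have h2 := hw (-(h • v)) (by rw [norm_neg, norm_smul, Real.norm_of_nonneg hh.le])
  rw [← ENNReal.ofReal_add (levyWeight_nonneg _) (levyWeight_nonneg _), smul_eq_mul,
    ← ENNReal.ofReal_mul (by positivity)]
  refine ENNReal.ofReal_le_ofReal ?_
  rw [inv_mul_le_iff₀ (by positivity)]
  linarith

lemma abs_secondDiff_sub_le {ψ : Euc N → ℝ} (hψ : IsTestFn ψ) (v : Euc N) :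
    ∃ B, 0 ≤ B ∧ ∀ x h, 0 < h →
      |(h ^ 2)⁻¹ * secondDiff ψ (h • v) x - fderiv ℝ (fun y => fderiv ℝ ψ y v) x v| ≤ B * h := by
  have hd : Differentiable ℝ ψ := (contDiff_infty.1 hψ.1 1).differentiable (by norm_num)
  have hD2 : ContDiff ℝ 2 fun y => fderiv ℝ ψ y v :=
    ((contDiff_infty.1 hψ.1 3).fderiv_right (m := 2) (by norm_num)).clm_apply contDiff_const
  have hDs : HasCompactSupport fun y => fderiv ℝ ψ y v := hψ.2.fderiv_apply ℝ v
  obtain ⟨B, hB, -, ht⟩ := exists_taylor_bound hD2 hDs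
  refine ⟨2 * B * ‖v‖ ^ 2, by positivity, fun x h hh => ?_⟩
  set D := fun y => fderiv ℝ ψ y v with hDdef
  set a := fderiv ℝ D x v with ha
  have hl : ∀ (c s : ℝ), HasDerivAt (fun s : ℝ => ψ (x + (c * s) • v)) (c * D (x + (c * s) • v)) s := by
    intro c s
    have h1 : HasDerivAt (fun s : ℝ => x + (c * s) • v) (c • v) s := by
      simpa using (((hasDerivAt_id s).const_mul c).smul_const v).const_add x
    have h2 := (hd (x + (c * s) • v)).hasFDerivAt.comp_hasDerivAt s h1
    rw [map_smul, smul_eq_mul] at h2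
    exact h2
  have hq : ∀ s, HasDerivAt
      (fun s : ℝ => ψ (x + (1 * s) • v) + ψ (x + (-1 * s) • v) - s ^ 2 * a)
      (1 * D (x + (1 * s) • v) + -1 * D (x + (-1 * s) • v) - 2 * s * a) s := by
    intro s
    refine ((hl 1 s).add (hl (-1) s)).sub ?_
    simpa using (hasDerivAt_pow 2 s).mul_const a
  have key := norm_image_sub_le_of_norm_deriv_le_segment' (a := 0) (b := h)
    (C := 2 * B * (h ^ 2 * ‖v‖ ^ 2)) (fun s _ => (hq s).hasDerivWithinAt) (fun s hs => by
      have h1 := ht x ((1 * s) • v)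
      have h2 := ht x ((-1 * s) • v)
      rw [map_smul, smul_eq_mul, norm_smul, mul_pow, Real.norm_eq_abs, sq_abs] at h1 h2
      have h3 : B * (s ^ 2 * ‖v‖ ^ 2) ≤ B * (h ^ 2 * ‖v‖ ^ 2) := by
        have := hs.1
        have := hs.2.le
        gcongr
      rw [abs_le] at h1 h2
      rw [Real.norm_eq_abs, abs_le]
      have e1 : (1 * s) ^ 2 = s ^ 2 := by ring
      have e2 : (-1 * s) ^ 2 = s ^ 2 := by ring
      rw [e1] at h1
      rw [e2] at h2
      constructor <;> linarith) h ⟨hh.le, le_rfl⟩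
  rw [Real.norm_eq_abs] at key
  have e : ψ (x + (1 * h) • v) + ψ (x + (-1 * h) • v) - h ^ 2 * a -
      (ψ (x + ((1 : ℝ) * 0) • v) + ψ (x + ((-1 : ℝ) * 0) • v) - 0 ^ 2 * a) =
      h ^ 2 * ((h ^ 2)⁻¹ * secondDiff ψ (h • v) x - a) := by
    rw [mul_sub, mul_inv_cancel_left₀ (by positivity), secondDiff]
    simp [sub_eq_add_neg]
    ring
  rw [e, abs_mul, abs_of_pos (by positivity : 0 < h ^ 2), sub_zero] at key
  refine le_of_mul_le_mul_left (key.trans_eq ?_) (by positivity : 0 < h ^ 2)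
  ring

lemma tendsto_lintegral_pairMeasure {ψ : Euc N → ℝ} (hψ : IsTestFn ψ) (v : Euc N) :
    Tendsto (fun n : ℕ => ∫⁻ x, ENNReal.ofReal
      |symOp (pairMeasure v (1 / ((n : ℝ) + 1))) ψ x - fderiv ℝ (fun y => fderiv ℝ ψ y v) x v|)
      atTop (𝓝 0) := by
  obtain ⟨B, hB, hb⟩ := abs_secondDiff_sub_le hψ v
  obtain ⟨R, hR⟩ := exists_norm_bound_support hψ.2
  obtain ⟨R', hR'⟩ := exists_norm_bound_support ((hψ.2.fderiv_apply ℝ v).fderiv_apply ℝ v)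
  set V := volume.real (Metric.closedBall (0 : Euc N) (max R R' + ‖v‖)) with hV
  have hle : ∀ n : ℕ, ∫⁻ x, ENNReal.ofReal
      |symOp (pairMeasure v (1 / ((n : ℝ) + 1))) ψ x - fderiv ℝ (fun y => fderiv ℝ ψ y v) x v| ≤
      ENNReal.ofReal (B * (1 / ((n : ℝ) + 1)) * V) := by
    intro n
    have hpos : 0 < 1 / ((n : ℝ) + 1) := by positivity
    have hle1 : 1 / ((n : ℝ) + 1) ≤ 1 := by
      rw [div_le_one (by positivity)]
      linarith [n.cast_nonneg (α := ℝ)]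
    refine lintegral_abs_le_of_support (by positivity) (fun x => ?_) fun x hx => ?_
    · rw [symOp_pairMeasure]
      exact hb x _ hpos
    · have hz : ‖(1 / ((n : ℝ) + 1)) • v‖ ≤ ‖v‖ := by
        rw [norm_smul, Real.norm_of_nonneg hpos.le]
        exact mul_le_of_le_one_left (norm_nonneg v) hle1
      set z := (1 / ((n : ℝ) + 1)) • v
      have hm1 := le_max_left R R'
      have hm2 := le_max_right R R'
      have h1 : R < ‖x + z‖ := by
        have := norm_sub_le (x + z) z
        rw [add_sub_cancel_right] at this
        linarith
      have h2 : R < ‖x - z‖ := by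
        have := norm_add_le (x - z) z
        rw [sub_add_cancel] at this
        linarith
      have h3 := norm_nonneg v
      rw [symOp_pairMeasure, secondDiff, hR _ h1, hR _ h2, hR x (by linarith),
        hR' x (by linarith)]
      simp
  have hlim : Tendsto (fun n : ℕ => ENNReal.ofReal (B * (1 / ((n : ℝ) + 1)) * V)) atTop (𝓝 0) := by
    have := ENNReal.tendsto_ofReal
      ((tendsto_one_div_add_atTop_nhds_zero_nat (𝕜 := ℝ)).const_mul B |>.mul_const V)
    simpa using this
  exact tendsto_of_tendsto_of_tendsto_of_le_of_le tendsto_const_nhds hlim (fun _ => zero_le) hle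

lemma tendsto_setLIntegral_levyWeight {μ : Measure (Euc N)} (hμ : IsLevyMeasure μ) :
    Tendsto (fun n : ℕ => ∫⁻ z in {z : Euc N | 1 / ((n : ℝ) + 1) < ‖z‖}ᶜ,
      ENNReal.ofReal (levyWeight z) ∂μ) atTop (𝓝 0) := by
  have hs : ∀ n : ℕ, MeasurableSet {z : Euc N | 1 / ((n : ℝ) + 1) < ‖z‖}ᶜ := fun n =>
    (measurableSet_lt (by fun_prop) (by fun_prop)).compl
  have hm := measurable_levyWeight (N := N) |>.ennreal_ofReal
  simp only [← lintegral_indicator (hs _)]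
  have := tendsto_lintegral_of_dominated_convergence (μ := μ)
    (F := fun n : ℕ => ({z : Euc N | 1 / ((n : ℝ) + 1) < ‖z‖}ᶜ).indicator
      fun z => ENNReal.ofReal (levyWeight z)) (f := fun _ => 0)
    (fun z => ENNReal.ofReal (levyWeight z)) (fun n => hm.indicator (hs n))
    (fun n => Eventually.of_forall fun z => indicator_le_self _ _ z) hμ.2.2
    (Eventually.of_forall fun z => ?_)
  · simpa using this
  · rcases eq_or_ne z 0 with rfl | hz
    · have h0 : ENNReal.ofReal (levyWeight (0 : Euc N)) = 0 := by simp [levyWeight]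
      simp [indicator_apply, h0]
    · refine tendsto_const_nhds.congr' ?_
      filter_upwards [(tendsto_one_div_add_atTop_nhds_zero_nat (𝕜 := ℝ)).eventually_lt_const
        (norm_pos_iff.2 hz)] with n hn
      rw [indicator_of_notMem]
      simpa using hn

/-- Finite symmetric measures approximating the generator `L^σ + L^μ`. -/
def levyApprox (P : ℕ) (σ : Fin P → Euc N) (μ : Measure (Euc N)) (n : ℕ) : Measure (Euc N) :=
  (∑ i, pairMeasure (σ i) (1 / ((n : ℝ) + 1))) + μ.restrict {z | 1 / ((n : ℝ) + 1) < ‖z‖}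

lemma measurable_fderiv_fderiv {ψ : Euc N → ℝ} (hψ : IsTestFn ψ) (v : Euc N) :
    Measurable fun x => fderiv ℝ (fun y => fderiv ℝ ψ y v) x v := by
  have h1 : ContDiff ℝ 2 fun y => fderiv ℝ ψ y v :=
    ((contDiff_infty.1 hψ.1 3).fderiv_right (m := 2) (by norm_num)).clm_apply contDiff_const
  exact ((h1.continuous_fderiv (by norm_num)).clm_apply continuous_const).measurable

theorem opApprox_levyApprox (P : ℕ) (σ : Fin P → Euc N) {μ : Measure (Euc N)}
    (hμ : IsLevyMeasure μ) :
    ∃ Λ, OpApprox (levyApprox P σ μ) (fun ψ x => Lsigma P σ ψ x + Lop μ ψ x) Λ := by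
  have hsig := hμ.sigmaFinite
  have hsm : ∀ n : ℕ, MeasurableSet {z : Euc N | 1 / ((n : ℝ) + 1) < ‖z‖} := fun n =>
    measurableSet_lt (by fun_prop) (by fun_prop)
  have hpf : ∀ n i, IsFiniteMeasure (pairMeasure (σ i) (1 / ((n : ℝ) + 1))) := fun n i =>
    isFiniteMeasure_pairMeasure _ _
  have hrf : ∀ n : ℕ, IsFiniteMeasure (μ.restrict {z : Euc N | 1 / ((n : ℝ) + 1) < ‖z‖}) :=
    fun n => ⟨by simpa using hμ.measure_lt_top (by positivity : 0 < 1 / ((n : ℝ) + 1))⟩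
  have hfin : ∀ n, IsFiniteMeasure (levyApprox P σ μ n) := by
    intro n
    unfold levyApprox
    have := hpf n
    have := hrf n
    infer_instance
  have hsymm : ∀ n, (levyApprox P σ μ n).map (fun z => -z) = levyApprox P σ μ n := by
    intro n
    have hpre : (fun z : Euc N => -z) ⁻¹' {z | 1 / ((n : ℝ) + 1) < ‖z‖} =
        {z | 1 / ((n : ℝ) + 1) < ‖z‖} := by
      ext z
      simp
    have hr := ((⟨by fun_prop, hμ.2.1⟩ : MeasurePreserving (fun z : Euc N => -z) μ μ
      ).restrict_preimage (hsm n)).map_eq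
    rw [hpre] at hr
    rw [levyApprox, Measure.map_add _ _ (by fun_prop), Measure.map_finset_sum (by fun_prop), hr]
    simp only [map_neg_pairMeasure]
  have hsplit : ∀ n ψ x, Measurable ψ → (∃ B, ∀ x, |ψ x| ≤ B) →
      symOp (levyApprox P σ μ n) ψ x = (∑ i, symOp (pairMeasure (σ i) (1 / ((n : ℝ) + 1))) ψ x) +
        symOp (μ.restrict {z | 1 / ((n : ℝ) + 1) < ‖z‖}) ψ x := by
    rintro n ψ x hm ⟨B, hB⟩
    have hi : ∀ m : Measure (Euc N), IsFiniteMeasure m →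
        Integrable (fun z => secondDiff ψ z x) m := by
      intro m hmf
      refine integrable_of_bound (C := 4 * B) (by unfold secondDiff; fun_prop) fun z => ?_
      have h1 := abs_le.1 (hB (x + z))
      have h2 := abs_le.1 (hB (x - z))
      have h3 := abs_le.1 (hB x)
      rw [secondDiff, abs_le]
      constructor <;> linarith
    simp only [symOp]
    have := hpf n
    rw [levyApprox, integral_add_measure (hi _ inferInstance) (hi _ (hrf n)),
      integral_finsetSum_measure fun i _ => hi _ (hpf n i), add_div, Finset.sum_div]
  set W := ∫⁻ z, ENNReal.ofReal (levyWeight z) ∂μ with hW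
  have hWt : W ≠ ⊤ := hμ.2.2
  have hΛ0 : 0 ≤ (∑ i, 2 * ‖σ i‖ ^ 2) + W.toReal :=
    add_nonneg (Finset.sum_nonneg fun i _ => by positivity) ENNReal.toReal_nonneg
  refine ⟨(∑ i, 2 * ‖σ i‖ ^ 2) + W.toReal, hfin, hsymm, hΛ0, ?_, ?_, ?_⟩
  · intro n ψ K hK
    have := hfin n
    rw [diffOp_eq_symOp (hsymm n) hK.meas hK.bdd]
    refine (hK.lintegral_symOp_le _).trans ?_
    rw [ENNReal.ofReal_mul hK.nonneg]
    gcongr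
    rw [ENNReal.ofReal_add (Finset.sum_nonneg fun i _ => by positivity) ENNReal.toReal_nonneg,
      ENNReal.ofReal_toReal hWt, ENNReal.ofReal_sum_of_nonneg fun i _ => by positivity, levyApprox,
      lintegral_add_measure, lintegral_finsetSum_measure]
    gcongr with i
    · exact lintegral_levyWeight_pairMeasure_le _ (by positivity)
    · exact setLIntegral_le_lintegral _ _
  · intro ψ hψ
    rw [Lop_eq_symOp hμ hψ]
    exact (Finset.measurable_sum _ fun i _ => measurable_fderiv_fderiv hψ (σ i)).add (measurable_symOp hψ.1.continuous.measurable)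
  · intro ψ hψ
    obtain ⟨K, hK⟩ := hψ.exists_sdiffBound
    have hlim : Tendsto (fun n : ℕ => (∑ i, ∫⁻ x, ENNReal.ofReal
        |symOp (pairMeasure (σ i) (1 / ((n : ℝ) + 1))) ψ x -
          fderiv ℝ (fun y => fderiv ℝ ψ y (σ i)) x (σ i)|) +
        ENNReal.ofReal K * ∫⁻ z in {z : Euc N | 1 / ((n : ℝ) + 1) < ‖z‖}ᶜ,
          ENNReal.ofReal (levyWeight z) ∂μ) atTop (𝓝 0) := by
      have h1 := tendsto_finsetSum Finset.univ fun i _ => tendsto_lintegral_pairMeasure hψ (σ i)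
      have h2 := ENNReal.Tendsto.const_mul (a := ENNReal.ofReal K)
        (tendsto_setLIntegral_levyWeight hμ) (Or.inr ENNReal.ofReal_ne_top)
      simpa using h1.add h2
    refine tendsto_of_tendsto_of_tendsto_of_le_of_le tendsto_const_nhds hlim
      (fun _ => zero_le) fun n => ?_
    have := hfin n
    refine le_trans ?_ (add_le_add_right (hK.lintegral_symOp_le
      (μ.restrict {z : Euc N | 1 / ((n : ℝ) + 1) < ‖z‖}ᶜ)) _)
    have hm : ∀ i, Measurable fun x => ENNReal.ofReal
        |symOp (pairMeasure (σ i) (1 / ((n : ℝ) + 1))) ψ x -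
          fderiv ℝ (fun y => fderiv ℝ ψ y (σ i)) x (σ i)| := by
      intro i
      have := hpf n i
      exact ((measurable_symOp hK.meas).sub
        (measurable_fderiv_fderiv hψ (σ i))).abs.ennreal_ofReal
    rw [← lintegral_finsetSum _ fun i _ => hm i,
      ← lintegral_add_left (Finset.measurable_sum _ fun i _ => hm i)]
    refine lintegral_mono fun x => ?_
    rw [← ENNReal.ofReal_sum_of_nonneg fun i _ => abs_nonneg _,
      ← ENNReal.ofReal_add (Finset.sum_nonneg fun i _ => abs_nonneg _) (abs_nonneg _)]
    refine ENNReal.ofReal_le_ofReal ?_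
    rw [diffOp_eq_symOp (hsymm n) hK.meas hK.bdd, hsplit n ψ x hK.meas hK.bdd,
      Lop_eq_symOp hμ hψ, symOp_restrict_add hμ hψ (hsm n) x, Lsigma,
      add_sub_add_comm, sub_add_cancel_left,
      ← Finset.sum_sub_distrib, ← sub_eq_add_neg]
    refine (abs_sub _ _).trans ?_
    gcongr
    exact Finset.abs_sum_le_sum_abs _ _

end

noncomputable section

variable {N : ℕ}

/-- On bounded intervals a continuous monotone function is a uniform limit of bounded monotone
Lipschitz functions. -/
lemma exists_lipschitz_approx {φ : ℝ → ℝ} (hc : Continuous φ) (hm : Monotone φ) {M : ℝ}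
    (hM : 0 ≤ M) {ε : ℝ} (hε : 0 < ε) :
    ∃ (g : ℝ → ℝ) (L : ℝ), 0 ≤ L ∧ Continuous g ∧ Monotone g ∧
      (∀ r, |g r| ≤ |φ M| + |φ (-M)|) ∧ (∀ r, |r| ≤ M → |g r - φ r| ≤ ε) ∧
      ∀ a b, a ≤ b → g b - g a ≤ L * (b - a) := by
  set f : ℝ → ℝ := fun r => φ (max (-M) (min r M)) with hf
  have hfc : Continuous f := by fun_prop
  have hfm : Monotone f := fun a b hab => hm (max_le_max_left _ (min_le_min_right _ hab))
  have hfb : ∀ r, |f r| ≤ |φ M| + |φ (-M)| := by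
    intro r
    have h1 : f r ≤ φ M := hm (max_le (by linarith) (min_le_right _ _))
    have h2 : φ (-M) ≤ f r := hm (le_max_left _ _)
    rw [abs_le]
    constructor
    · linarith [neg_abs_le (φ (-M)), abs_nonneg (φ M)]
    · linarith [le_abs_self (φ M), abs_nonneg (φ (-M))]
  have hfe : ∀ r, |r| ≤ M → f r = φ r := by
    intro r hr
    rw [abs_le] at hr
    simp only [hf, min_eq_left hr.2, max_eq_right hr.1]
  obtain ⟨δ, hδ, hu⟩ := Metric.uniformContinuousOn_iff.1
    ((isCompact_Icc (a := -M) (b := M + 1)).uniformContinuousOn_of_continuous hfc.continuousOn) ε hε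
  set h := min (δ / 2) 1 with hh
  have hh0 : 0 < h := by positivity
  have hhδ : h < δ := (min_le_left _ _).trans_lt (by linarith)
  have hh1 : h ≤ 1 := min_le_right _ _
  set F : ℝ → ℝ := fun x => ∫ s in (0 : ℝ)..x, f s with hF
  have hFd : ∀ x, HasDerivAt F (f x) x := fun x => (hfc.integral_hasStrictDerivAt 0 x).hasDerivAt
  have hgd : ∀ x, HasDerivAt (fun r => (F (r + h) - F r) / h) ((f (x + h) - f x) / h) x := fun x =>
    (((hFd (x + h)).comp_add_const x h).sub (hFd x)).div_const h
  have hmv : ∀ r, ∃ c ∈ Ioo r (r + h), f c = (F (r + h) - F r) / h := by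
    intro r
    obtain ⟨c, hc, he⟩ := exists_hasDerivAt_eq_slope F f (lt_add_of_pos_right r hh0)
      (fun x _ => (hFd x).continuousAt.continuousWithinAt) fun x _ => hFd x
    exact ⟨c, hc, by rw [he, add_sub_cancel_left]⟩
  have hdiff : Differentiable ℝ fun r => (F (r + h) - F r) / h := fun x =>
    (hgd x).differentiableAt
  refine ⟨fun r => (F (r + h) - F r) / h, 2 * (|φ M| + |φ (-M)|) / h, by positivity,
    hdiff.continuous, ?_, ?_, ?_, ?_⟩
  · refine monotone_of_deriv_nonneg hdiff fun x => ?_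
    rw [(hgd x).deriv]
    exact div_nonneg (sub_nonneg.2 (hfm (by linarith))) hh0.le
  · intro r
    obtain ⟨c, -, he⟩ := hmv r
    simp only [← he]
    exact hfb c
  · intro r hr
    obtain ⟨c, hc, he⟩ := hmv r
    simp only [← he]
    rw [← hfe r hr, ← Real.dist_eq]
    rw [abs_le] at hr
    refine (hu c ⟨by linarith [hc.1], by linarith [hc.2]⟩ r ⟨hr.1, by linarith⟩ ?_).le
    rw [Real.dist_eq, abs_of_pos (by linarith [hc.1])]
    linarith [hc.2]
  · refine fun a b hab => image_sub_le_mul_sub_of_deriv_le hdiff (fun x => ?_) hab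
    rw [(hgd x).deriv]
    gcongr
    linarith [(abs_le.1 (hfb (x + h))).2, (abs_le.1 (hfb x)).1]

/-- Stability of `∫ G(a) f` under local `L¹` perturbations of bounded functions `a`. -/
lemma exists_ballDist_imp_integral_le {G : ℝ → ℝ} (hG : Continuous G) (M : ℝ) {f : Euc N → ℝ}
    (hf : Integrable f) {ε : ℝ} (hε : 0 < ε) :
    ∃ η > 0, ∃ R, ∀ a b, BddMeas M a → BddMeas M b → ballDist R a b ≤ η →
      |(∫ x, G (a x) * f x) - ∫ x, G (b x) * f x| ≤ ε := by
  obtain ⟨C, hC⟩ := (isCompact_Icc (a := -M) (b := M)).exists_bound_of_continuousOn hG.continuousOn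
  set C' := max C 0 with hC'
  have hC'0 : 0 ≤ C' := le_max_right _ _
  have hGb : ∀ r, |r| ≤ M → |G r| ≤ C' := fun r hr => (hC r (abs_le.1 hr)).trans (le_max_left _ _)
  obtain ⟨f', hs', hd', hc', hi'⟩ := hf.exists_hasCompactSupport_integral_sub_le
    (ε := ε / (3 * (2 * C' + 1))) (by positivity)
  obtain ⟨B, hB⟩ := hs'.exists_bound_of_continuous hc'
  have hB0 : 0 ≤ B := (norm_nonneg _).trans (hB 0)
  obtain ⟨R, hR⟩ := exists_norm_bound_support hs'
  set V := volume.real (Metric.closedBall (0 : Euc N) R) with hV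
  have hV0 : 0 ≤ V := measureReal_nonneg
  set ε₁ := ε / (3 * (B * V + 1)) with hε₁
  have hε₁0 : 0 < ε₁ := by positivity
  obtain ⟨δ, hδ, hu⟩ := Metric.uniformContinuousOn_iff.1
    ((isCompact_Icc (a := -M) (b := M)).uniformContinuousOn_of_continuous hG.continuousOn) ε₁ hε₁0
  have hGd : ∀ r s, |r| ≤ M → |s| ≤ M → |G r - G s| ≤ ε₁ + 2 * C' / δ * |r - s| := by
    intro r s hr hs
    rcases lt_or_ge |r - s| δ with h | h
    · have h1 := hu r (abs_le.1 hr) s (abs_le.1 hs) h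
      rw [Real.dist_eq] at h1
      have : 0 ≤ 2 * C' / δ * |r - s| := by positivity
      linarith
    · have h1 : 2 * C' ≤ 2 * C' / δ * |r - s| := by
        rw [div_mul_eq_mul_div, le_div_iff₀ hδ]
        gcongr
      linarith [abs_sub (G r) (G s), hGb r hr, hGb s hs]
  refine ⟨ε / (3 * (B * (2 * C' / δ) + 1)), by positivity, R, fun a b ha hb hab => ?_⟩
  have hint : ∀ {a : Euc N → ℝ} {f : Euc N → ℝ}, BddMeas M a → Integrable f →
      Integrable fun x => G (a x) * f x := fun {a f} ha hf =>
    hf.bdd_mul (c := C') (hG.measurable.comp ha.1).aestronglyMeasurable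
      (Eventually.of_forall fun x => hGb _ (ha.2 x))
  have hb1 : |∫ x, (G (a x) * f x - G (b x) * f x) - (G (a x) * f' x - G (b x) * f' x)| ≤
      2 * C' * (ε / (3 * (2 * C' + 1))) := by
    rw [← Real.norm_eq_abs]
    refine (norm_integral_le_of_norm_le ((hf.sub hi').norm.const_mul (2 * C'))
      (Eventually.of_forall fun x => ?_)).trans ?_
    · have e : G (a x) * f x - G (b x) * f x - (G (a x) * f' x - G (b x) * f' x) =
        (G (a x) - G (b x)) * (f x - f' x) := by ring
      rw [e, norm_mul, Pi.sub_apply]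
      gcongr
      rw [Real.norm_eq_abs]
      linarith [abs_sub (G (a x)) (G (b x)), hGb _ (ha.2 x), hGb _ (hb.2 x)]
    · rw [integral_const_mul]
      gcongr
      exact hd'
  have hb2 : |∫ x, (G (a x) * f' x - G (b x) * f' x)| ≤
      B * (ε₁ * V + 2 * C' / δ * (ε / (3 * (B * (2 * C' / δ) + 1)))) := by
    have hfin : IsFiniteMeasure ((volume : Measure (Euc N)).restrict (Metric.closedBall 0 R)) :=
      ⟨by simpa using (isCompact_closedBall (0 : Euc N) R).measure_lt_top⟩
    have hzero : ∀ x ∉ Metric.closedBall (0 : Euc N) R, G (a x) * f' x - G (b x) * f' x = 0 := by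
      intro x hx
      rw [hR x (by simpa using hx)]
      ring
    rw [← setIntegral_eq_integral_of_forall_compl_eq_zero hzero]
    have hid : IntegrableOn (fun x => |a x - b x|) (Metric.closedBall 0 R) :=
      ((ha.integrableOn R).sub (hb.integrableOn R)).abs
    rw [← Real.norm_eq_abs]
    refine (norm_integral_le_of_norm_le
      (((integrable_const ε₁).add (hid.const_mul (2 * C' / δ))).const_mul B)
      (Eventually.of_forall fun x => ?_)).trans ?_
    · rw [← sub_mul, norm_mul, mul_comm]
      gcongr
      · exact hB x
      · exact hGd _ _ (ha.2 x) (hb.2 x)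
    · rw [integral_const_mul]
      gcongr
      simp only [Pi.add_apply]
      rw [integral_add (integrable_const ε₁) (hid.const_mul _), integral_const, integral_const_mul]
      gcongr
      · simp [hV, mul_comm]
      · exact hab
  have hI1 := (hint ha hf).sub (hint hb hf)
  have hI2 := (hint ha hi').sub (hint hb hi')
  have e := integral_sub hI1 hI2
  simp only [Pi.sub_apply] at e
  rw [e, integral_sub (hint ha hf) (hint hb hf)] at hb1
  have n1 : 2 * C' * (ε / (3 * (2 * C' + 1))) ≤ ε / 3 := by
    rw [mul_div_assoc', div_le_div_iff₀ (by positivity) (by positivity)]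
    nlinarith
  have n2 : B * (ε₁ * V) ≤ ε / 3 := by
    rw [hε₁, div_mul_eq_mul_div, mul_div_assoc', div_le_div_iff₀ (by positivity) (by positivity)]
    nlinarith
  have n3 : B * (2 * C' / δ * (ε / (3 * (B * (2 * C' / δ) + 1)))) ≤ ε / 3 := by
    have : 0 ≤ 2 * C' / δ := by positivity
    set q := 2 * C' / δ
    have : 0 ≤ B * q := by positivity
    rw [mul_div_assoc', mul_div_assoc', div_le_div_iff₀ (by positivity) (by positivity)]
    nlinarith
  rw [mul_add] at hb2
  rw [abs_le] at hb1 hb2 ⊢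
  constructor <;> linarith [hb1.1, hb1.2, hb2.1, hb2.2]

end

noncomputable section

variable {N : ℕ}

lemma abs_integral_mul_le {a f : Euc N → ℝ} {C E : ℝ} (hC : 0 ≤ C) (hE : 0 ≤ E)
    (ha : ∀ x, |a x| ≤ C) (hf : ∫⁻ x, ENNReal.ofReal |f x| ≤ ENNReal.ofReal E) :
    |∫ x, a x * f x| ≤ C * E := by
  rw [← ENNReal.ofReal_le_ofReal_iff (by positivity)]
  refine (ofReal_abs_integral_le _).trans ?_
  calc ∫⁻ x, ENNReal.ofReal |a x * f x|
      ≤ ∫⁻ x, ENNReal.ofReal C * ENNReal.ofReal |f x| := by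
        refine lintegral_mono fun x => ?_
        rw [← ENNReal.ofReal_mul hC, abs_mul]
        refine ENNReal.ofReal_le_ofReal ?_
        gcongr
        exact ha x
    _ = ENNReal.ofReal C * ∫⁻ x, ENNReal.ofReal |f x| :=
        lintegral_const_mul' _ _ ENNReal.ofReal_ne_top
    _ ≤ ENNReal.ofReal (C * E) := by
        rw [ENNReal.ofReal_mul hC]
        gcongr

lemma StableStep.abs_integral_euler_sub_le {ν : Measure (Euc N)} {g : ℝ → ℝ} {τ C : ℝ}
    (h : StableStep ν g τ C) {u ψ : Euc N → ℝ} (hu : Measurable u) {M : ℝ}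
    (hM : ∀ x, |u x| ≤ M) (hψ : Integrable ψ) {c e : ℝ} {k l : ℕ} (hkl : k ≤ l)
    (hF : ∀ j, k ≤ j → j < l → |(∫ x, g (euler ν g τ u j x) * diffOp ν ψ x) - c| ≤ e) :
    |(∫ x, ψ x * euler ν g τ u l x) - (∫ x, ψ x * euler ν g τ u k x) - ((l : ℝ) - k) * τ * c| ≤
      ((l : ℝ) - k) * τ * e := by
  induction l, hkl using Nat.le_induction with
  | base => simp
  | succ l hkl ih =>
    have h1 := abs_le.1 (ih fun j hj hjl => hF j hj (by omega))
    have h2 := abs_le.1 (hF l hkl (by omega))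
    have hτ := h.pos.le
    have h3 := mul_le_mul_of_nonneg_left h2.1 hτ
    have h4 := mul_le_mul_of_nonneg_left h2.2 hτ
    rw [h.integral_mul_euler_succ hu hM hψ, abs_le]
    push_cast
    constructor <;> linarith

lemma floor_div_sub_mul_le {τ s t : ℝ} (hτ : 0 < τ) (hst : s ≤ t) :
    ((⌊t / τ⌋₊ : ℝ) - ⌊s / τ⌋₊) * τ ≤ t - s + τ := by
  rcases le_or_gt 0 t with ht | ht
  · have h1 : (⌊t / τ⌋₊ : ℝ) ≤ t / τ := Nat.floor_le (by positivity)
    have h2 : s / τ < ⌊s / τ⌋₊ + 1 := Nat.lt_floor_add_one _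
    rw [le_div_iff₀ hτ] at h1
    rw [div_lt_iff₀ hτ] at h2
    linarith
  · rw [Nat.floor_of_nonpos (div_nonpos_of_nonpos_of_nonneg ht.le hτ.le),
      Nat.floor_of_nonpos (div_nonpos_of_nonpos_of_nonneg (hst.trans ht.le) hτ.le)]
    simp
    linarith

lemma abs_floor_div_mul_sub_le {τ t : ℝ} (hτ : 0 < τ) (ht : 0 ≤ t) :
    |(⌊t / τ⌋₊ : ℝ) * τ - t| ≤ τ := by
  have h1 : (⌊t / τ⌋₊ : ℝ) ≤ t / τ := Nat.floor_le (by positivity)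
  have h2 : t / τ < ⌊t / τ⌋₊ + 1 := Nat.lt_floor_add_one _
  rw [le_div_iff₀ hτ] at h1
  rw [div_lt_iff₀ hτ] at h2
  rw [abs_le]
  constructor <;> linarith

lemma SdiffBound.shift {ψ : Euc N → ℝ} {K : ℝ} (h : SdiffBound ψ K) (y : Euc N) :
    SdiffBound (fun x => ψ (x - y)) K := by
  refine ⟨h.meas.comp (by fun_prop), ?_, h.nonneg, fun z => ?_⟩
  · obtain ⟨B, hB⟩ := h.bdd
    exact ⟨B, fun x => hB _⟩
  · have e : ∀ x, secondDiff (fun x => ψ (x - y)) z x = secondDiff ψ z (x - y) := by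
      intro x
      simp only [secondDiff]
      rw [show x + z - y = x - y + z by abel, sub_right_comm]
    simp only [e]
    rw [lintegral_sub_right_eq_self (fun x => ENNReal.ofReal |secondDiff ψ z x|)]
    exact h.le z

/-- Consistent family of stable explicit schemes for `∂_t u = A[φ(u)]` with initial datum `v`. -/
structure Scheme (ν : ℕ → Measure (Euc N)) (A : (Euc N → ℝ) → Euc N → ℝ) (Λ : ℝ) (φ : ℝ → ℝ)
    (M C : ℝ) (g : ℕ → ℝ → ℝ) (τ : ℕ → ℝ) (v : Euc N → ℝ) : Prop where
  approx : OpApprox ν A Λ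
  cont : Continuous φ
  stable : ∀ n, StableStep (ν n) (g n) (τ n) C
  tau_le : ∀ n, τ n ≤ 1 / ((n : ℝ) + 1)
  close : ∀ n r, |r| ≤ M → |g n r - φ r| ≤ 1 / ((n : ℝ) + 1)
  init : BddMeas M v
  integrable : Integrable v

/-- The piecewise constant in time interpolation of the explicit schemes. -/
def interp (ν : ℕ → Measure (Euc N)) (g : ℕ → ℝ → ℝ) (τ : ℕ → ℝ) (v : Euc N → ℝ) (n : ℕ) (t : ℝ) :
    Euc N → ℝ :=
  euler (ν n) (g n) (τ n) v ⌊t / τ n⌋₊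

/-- Bounded integrable functions, continuous in time for the local `L¹` topology, which start from
`v` and solve `∂_t u = A[φ(u)]` weakly, pointwise in time. -/
structure WeakFlow (A : (Euc N → ℝ) → Euc N → ℝ) (φ : ℝ → ℝ) (M : ℝ) (v : Euc N → ℝ)
    (u : Euc N → ℝ → ℝ) : Prop where
  meas : Measurable (Function.uncurry u)
  bdd : ∀ x t, |u x t| ≤ M
  integrable : ∀ t, Integrable fun x => u x t
  integral_le : ∃ I, ∀ t, ∫ x, |u x t| ≤ I
  cont : ∀ R, ∀ ε > 0, ∃ δ > 0, ∀ s t, |t - s| < δ →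
    ballDist R (fun x => u x t) (fun x => u x s) ≤ ε
  init : ∀ f, Integrable f → ∫ x, u x 0 * f x = ∫ x, v x * f x
  weak : ∀ ψ, IsTestFn ψ → ∀ ε > 0, ∃ δ > 0, ∀ s t, 0 ≤ s → s ≤ t → t - s < δ →
    |(∫ x, u x t * ψ x) - (∫ x, u x s * ψ x) - (t - s) * ∫ x, φ (u x s) * A ψ x| ≤ ε * (t - s)

lemma tendsto_integral_comp {G : ℝ → ℝ} (hG : Continuous G) {M : ℝ} {f : Euc N → ℝ}
    (hf : Integrable f) {l : Filter ℕ} {w : ℕ → Euc N → ℝ} {u : Euc N → ℝ}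
    (hw : ∀ n, BddMeas M (w n)) (hu : BddMeas M u)
    (hlim : ∀ R, Tendsto (fun n => ballDist R (w n) u) l (𝓝 0)) :
    Tendsto (fun n => ∫ x, G (w n x) * f x) l (𝓝 (∫ x, G (u x) * f x)) := by
  rw [Metric.tendsto_nhds]
  intro ε hε
  obtain ⟨η, hη, R, hR⟩ := exists_ballDist_imp_integral_le hG M hf (half_pos hε)
  filter_upwards [(hlim R).eventually_le_const hη] with n hn
  rw [Real.dist_eq]
  exact (hR _ _ (hw n) hu hn).trans_lt (half_lt_self hε)

namespace Scheme

variable {ν : ℕ → Measure (Euc N)} {A : (Euc N → ℝ) → Euc N → ℝ} {Λ : ℝ} {φ : ℝ → ℝ}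
    {M C : ℝ} {g : ℕ → ℝ → ℝ} {τ : ℕ → ℝ} {v : Euc N → ℝ}

lemma nonneg (h : Scheme ν A Λ φ M C g τ v) : 0 ≤ C :=
  (abs_nonneg _).trans ((h.stable 0).bound 0)

lemma tendsto_tau (h : Scheme ν A Λ φ M C g τ v) : Tendsto τ atTop (𝓝 0) :=
  squeeze_zero (fun n => (h.stable n).pos.le) h.tau_le tendsto_one_div_add_atTop_nhds_zero_nat

lemma bddMeas_euler (h : Scheme ν A Λ φ M C g τ v) (n k : ℕ) :
    BddMeas M (euler (ν n) (g n) (τ n) v k) :=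
  ⟨(h.stable n).measurable_euler h.init.1 k, (h.stable n).abs_euler_le h.init.1 h.init.2 k⟩

lemma abs_integral_interp_sub_le (h : Scheme ν A Λ φ M C g τ v) {ψ : Euc N → ℝ}
    (hi : Integrable ψ) {K : ℝ} (hK : SdiffBound ψ K) (n : ℕ) {s t : ℝ} (hst : s ≤ t) :
    |(∫ x, ψ x * interp ν g τ v n t x) - ∫ x, ψ x * interp ν g τ v n s x| ≤
      C * (K * Λ) * (|t - s| + τ n) := by
  have hτ := (h.stable n).pos
  have hC := h.nonneg
  have hK0 := hK.nonneg
  have hΛ := h.approx.nonneg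
  have hfl : ⌊s / τ n⌋₊ ≤ ⌊t / τ n⌋₊ := Nat.floor_mono (by gcongr)
  have key := (h.stable n).abs_integral_euler_sub_le h.init.1 h.init.2 hi (c := 0)
    (e := C * (K * Λ)) hfl (fun j _ _ => by
      rw [sub_zero]
      exact abs_integral_mul_le hC (by positivity) (fun x => (h.stable n).bound _)
        (h.approx.bound n ψ K hK))
  rw [mul_zero, sub_zero] at key
  refine key.trans ?_
  rw [mul_comm, abs_of_nonneg (sub_nonneg.2 hst)]
  gcongr
  exact floor_div_sub_mul_le hτ hst

lemma equiFamily (h : Scheme ν A Λ φ M C g τ v) : EquiFamily (interp ν g τ v) τ M := by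
  refine ⟨fun n t => h.bddMeas_euler n _, h.tendsto_tau, fun ε hε => ?_, fun ρ hρ => ?_⟩
  · have := (tendsto_lintegral_shift h.integrable).eventually_le_const
      (ENNReal.ofReal_pos.2 hε)
    obtain ⟨r, hr, hb⟩ := Metric.eventually_nhds_iff.1 this
    refine ⟨r, hr, fun n t y hy => ?_⟩
    exact ((h.stable n).lintegral_euler_shift_le h.init.1 _ y).trans
      (hb (by rwa [dist_zero_right]))
  · obtain ⟨K, hK⟩ := hρ.exists_sdiffBound
    have hC := h.nonneg
    have hK0 := hK.nonneg
    have hΛ := h.approx.nonneg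
    refine ⟨C * (K * Λ), by positivity, fun n s t x => ?_⟩
    have hi : Integrable fun y => ρ (y - x) := hρ.integrable.comp_sub_right x
    rcases le_total s t with hst | hst
    · exact h.abs_integral_interp_sub_le hi (hK.shift x) n hst
    · rw [abs_sub_comm, abs_sub_comm t s]
      exact h.abs_integral_interp_sub_le hi (hK.shift x) n hst

/-- Consistency of the discrete fluxes. -/
lemma eventually_flux_sub_le (h : Scheme ν A Λ φ M C g τ v) {ψ : Euc N → ℝ} (hψ : IsTestFn ψ)
    {ε : ℝ} (hε : 0 < ε) :
    ∀ᶠ n in atTop, ∀ a, BddMeas M a →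
      |(∫ x, g n (a x) * diffOp (ν n) ψ x) - ∫ x, φ (a x) * A ψ x| ≤ ε := by
  obtain ⟨K, hK⟩ := hψ.exists_sdiffBound
  have hC := h.nonneg
  have hK0 := hK.nonneg
  have hΛ := h.approx.nonneg
  have e1 : ∀ᶠ n : ℕ in atTop, ∫⁻ x, ENNReal.ofReal |diffOp (ν n) ψ x - A ψ x| ≤
      ENNReal.ofReal (ε / (2 * (C + 1))) :=
    (h.approx.lim ψ hψ).eventually_le_const (ENNReal.ofReal_pos.2 (by positivity))
  have e2 : ∀ᶠ n : ℕ in atTop, 1 / ((n : ℝ) + 1) ≤ ε / (2 * (K * Λ + 1)) :=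
    (tendsto_one_div_add_atTop_nhds_zero_nat (𝕜 := ℝ)).eventually_le_const (by positivity)
  filter_upwards [e1, e2] with n h1 h2 a ha
  have := (h.stable n).finite
  have hA := h.approx.integrable hψ
  have hd : Integrable (diffOp (ν n) ψ) := by
    refine ⟨(measurable_diffOp hK.meas).aestronglyMeasurable, ?_⟩
    rw [hasFiniteIntegral_iff_enorm]
    simp only [Real.enorm_eq_ofReal_abs]
    exact (h.approx.bound n ψ K hK).trans_lt ENNReal.ofReal_lt_top
  have hga : Measurable fun x => g n (a x) := (h.stable n).cont.measurable.comp ha.1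
  have hφa : Measurable fun x => φ (a x) := h.cont.measurable.comp ha.1
  have hφb : ∀ x, |g n (a x) - φ (a x)| ≤ 1 / ((n : ℝ) + 1) := fun x => h.close n _ (ha.2 x)
  have i1 : Integrable fun x => g n (a x) * (diffOp (ν n) ψ x - A ψ x) :=
    (hd.sub hA).bdd_mul (c := C) hga.aestronglyMeasurable
      (Eventually.of_forall fun x => (h.stable n).bound _)
  have i2 : Integrable fun x => (g n (a x) - φ (a x)) * A ψ x :=
    hA.bdd_mul (c := 1 / ((n : ℝ) + 1)) (hga.sub hφa).aestronglyMeasurable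
      (Eventually.of_forall hφb)
  have i3 : Integrable fun x => g n (a x) * diffOp (ν n) ψ x :=
    hd.bdd_mul (c := C) hga.aestronglyMeasurable
      (Eventually.of_forall fun x => (h.stable n).bound _)
  have i4 : Integrable fun x => φ (a x) * A ψ x := by
    have := (hA.bdd_mul (c := C) hga.aestronglyMeasurable
      (Eventually.of_forall fun x => (h.stable n).bound _)).sub i2
    refine this.congr (Eventually.of_forall fun x => ?_)
    simp only [Pi.sub_apply]
    ring
  have e : (∫ x, g n (a x) * diffOp (ν n) ψ x) - ∫ x, φ (a x) * A ψ x =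
      (∫ x, g n (a x) * (diffOp (ν n) ψ x - A ψ x)) + ∫ x, (g n (a x) - φ (a x)) * A ψ x := by
    rw [← integral_sub i3 i4, ← integral_add i1 i2]
    congr 1
    funext x
    ring
  rw [e]
  refine (abs_add_le _ _).trans ?_
  have b1 := abs_integral_mul_le hC (by positivity) (fun x => (h.stable n).bound (a x)) h1
  have b2 := abs_integral_mul_le (by positivity) (by positivity) hφb (h.approx.lintegral_le hψ hK)
  have n1 : C * (ε / (2 * (C + 1))) ≤ ε / 2 := by
    rw [mul_div_assoc', div_le_div_iff₀ (by positivity) (by positivity)]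
    nlinarith
  have n2 : ε / (2 * (K * Λ + 1)) * (K * Λ) ≤ ε / 2 := by
    have : 0 ≤ K * Λ := by positivity
    rw [div_mul_eq_mul_div, div_le_div_iff₀ (by positivity) (by positivity)]
    nlinarith
  have n3 : 1 / ((n : ℝ) + 1) * (K * Λ) ≤ ε / (2 * (K * Λ + 1)) * (K * Λ) := by gcongr
  linarith

end Scheme

end

noncomputable section

variable {N : ℕ}

lemma ballDist_le_of_tendsto {M : ℝ} {w w' : ℕ → Euc N → ℝ} {u u' : Euc N → ℝ} {l : Filter ℕ}
    [l.NeBot] (hw : ∀ n, BddMeas M (w n)) (hw' : ∀ n, BddMeas M (w' n)) (hu : BddMeas M u)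
    (hu' : BddMeas M u') {R ε : ℝ} (h : Tendsto (fun n => ballDist R (w n) u) l (𝓝 0))
    (h' : Tendsto (fun n => ballDist R (w' n) u') l (𝓝 0))
    (hle : ∀ᶠ n in l, ballDist R (w n) (w' n) ≤ ε) : ballDist R u u' ≤ ε := by
  have hlim : Tendsto (fun n => ballDist R (w n) u + ε + ballDist R (w' n) u') l (𝓝 ε) := by
    simpa using (h.add_const ε).add h'
  refine ge_of_tendsto hlim ?_
  filter_upwards [hle] with n hn
  have h1 := ballDist_triangle hu (hw n) hu' R
  have h2 := ballDist_triangle (hw n) (hw' n) hu' R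
  rw [ballDist_comm R u (w n)] at h1
  linarith

lemma integrable_of_ballDist_zero_le {M I : ℝ} {u : Euc N → ℝ} (hu : BddMeas M u)
    (h : ∀ R, ballDist R u (fun _ => 0) ≤ I) : Integrable u ∧ ∫ x, |u x| ≤ I := by
  have hc : AECover (volume : Measure (Euc N)) atTop fun n : ℕ => Metric.closedBall 0 (n : ℝ) :=
    aecover_closedBall tendsto_natCast_atTop_atTop
  simp only [ballDist, sub_zero] at h
  have hi : Integrable u := hc.integrable_of_integral_norm_bounded I (fun n => hu.integrableOn n)
    (Eventually.of_forall fun n => h n)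
  exact ⟨hi, le_of_tendsto' (hc.integral_tendsto_of_countably_generated hi.abs) fun n => h n⟩

theorem Scheme.exists_weakFlow {ν : ℕ → Measure (Euc N)} {A : (Euc N → ℝ) → Euc N → ℝ} {Λ : ℝ}
    {φ : ℝ → ℝ} {M C : ℝ} {g : ℕ → ℝ → ℝ} {τ : ℕ → ℝ} {v : Euc N → ℝ}
    (h : Scheme ν A Λ φ M C g τ v) : ∃ u, WeakFlow A φ M v u := by
  have hE := h.equiFamily
  obtain ⟨l, hl⟩ : ∃ l : Ultrafilter ℕ, (l : Filter ℕ) ≤ atTop :=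
    ⟨hyperfilter ℕ, Nat.hyperfilter_le_atTop⟩
  obtain ⟨u, hum, hub, hlim⟩ := hE.exists_limit l hl
  have hτ : Tendsto τ l (𝓝 0) := h.tendsto_tau.mono_left hl
  have hu : ∀ t, BddMeas M fun x => u x t := fun t =>
    ⟨hum.comp (measurable_id.prodMk measurable_const), fun x => hub x t⟩
  have hM : 0 ≤ M := (abs_nonneg _).trans (hub 0 0)
  have h0 : BddMeas M fun _ : Euc N => 0 := ⟨measurable_const, fun x => by simpa using hM⟩
  have hI : ∀ t, Integrable (fun x => u x t) ∧ ∫ x, |u x t| ≤ ∫ x, |v x| := by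
    intro t
    refine integrable_of_ballDist_zero_le (hu t) fun R => ?_
    have hc : Tendsto (fun _ : ℕ => ballDist R (fun _ : Euc N => (0 : ℝ)) fun _ => 0) l (𝓝 0) := by
      simp [ballDist]
    refine ballDist_le_of_tendsto (fun n => hE.bdd n t) (fun _ => h0) (hu t) h0 (hlim t R) hc
      (Eventually.of_forall fun n => ?_)
    refine ballDist_le_of_lintegral (hE.bdd n t).1 measurable_const
      (integral_nonneg fun _ => abs_nonneg _) ?_ R
    simp only [sub_zero]
    rw [ofReal_integral_eq_lintegral_ofReal h.integrable.abs
      (Eventually.of_forall fun _ => abs_nonneg _)]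
    exact (h.stable n).lintegral_euler_le h.init.1 _
  have hpair : ∀ {f : Euc N → ℝ}, Integrable f → ∀ t,
      Tendsto (fun n => ∫ x, interp ν g τ v n t x * f x) l (𝓝 (∫ x, u x t * f x)) :=
    fun hf t => tendsto_integral_comp continuous_id hf (fun n => hE.bdd n t) (hu t) (hlim t)
  refine ⟨u, hum, hub, fun t => (hI t).1, ⟨_, fun t => (hI t).2⟩, fun R ε hε => ?_, fun f hf => ?_,
    fun ψ hψ ε hε => ?_⟩
  · obtain ⟨δ, hδ, hd⟩ := hE.equicontinuous R hε
    refine ⟨δ, hδ, fun s t hst => ?_⟩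
    refine ballDist_le_of_tendsto (fun n => hE.bdd n t) (fun n => hE.bdd n s) (hu t) (hu s)
      (hlim t R) (hlim s R) ?_
    filter_upwards [hτ.eventually_lt_const (sub_pos.2 hst)] with n hn
    exact hd n s t (by linarith)
  · refine tendsto_nhds_unique (hpair hf 0) ?_
    simp [interp, euler]
  · obtain ⟨η, hη, R, hR⟩ := exists_ballDist_imp_integral_le h.cont M (h.approx.integrable hψ)
      (half_pos hε)
    obtain ⟨δ, hδ, hd⟩ := hE.equicontinuous R hη
    refine ⟨δ, hδ, fun s t hs hst htδ => ?_⟩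
    have ht : 0 ≤ t := hs.trans hst
    have hfl : ∀ {t : ℝ}, 0 ≤ t → Tendsto (fun n => (⌊t / τ n⌋₊ : ℝ) * τ n) l (𝓝 t) := by
      intro t ht
      rw [tendsto_iff_norm_sub_tendsto_zero]
      exact squeeze_zero (fun _ => norm_nonneg _)
        (fun n => abs_floor_div_mul_sub_le (h.stable n).pos ht) hτ
    have hk : Tendsto (fun n => ((⌊t / τ n⌋₊ : ℝ) - ⌊s / τ n⌋₊) * τ n) l (𝓝 (t - s)) := by
      simpa only [sub_mul] using (hfl ht).sub (hfl hs)
    have hG := tendsto_integral_comp h.cont (h.approx.integrable hψ) (fun n => hE.bdd n s) (hu s)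
      (hlim s)
    have hL := (((hpair hψ.integrable t).sub (hpair hψ.integrable s)).sub (hk.mul hG)).abs
    have hRt := hk.mul_const ε
    rw [mul_comm ε]
    refine le_of_tendsto_of_tendsto hL hRt ?_
    filter_upwards [hl (h.eventually_flux_sub_le hψ (half_pos hε)),
      hτ.eventually_lt_const (half_pos (sub_pos.2 htδ))] with n hn hτn
    have hτ0 := (h.stable n).pos
    have key := (h.stable n).abs_integral_euler_sub_le h.init.1 h.init.2 hψ.integrable
      (c := ∫ x, φ (interp ν g τ v n s x) * A ψ x) (e := ε) (k := ⌊s / τ n⌋₊) (l := ⌊t / τ n⌋₊)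
      (Nat.floor_mono (by gcongr)) (fun j hj hjl => by
        have hw : euler (ν n) (g n) (τ n) v j = interp ν g τ v n (j * τ n) := by
          rw [interp, mul_div_cancel_right₀ _ hτ0.ne', Nat.floor_natCast]
        have h1 := hn _ (h.bddMeas_euler n j)
        have j1 : (j : ℝ) * τ n ≤ t := by
          rw [← le_div_iff₀ hτ0]
          exact (Nat.cast_le.2 hjl.le).trans (Nat.floor_le (by positivity))
        have j2 : s - τ n ≤ j * τ n := by
          have h2 := (abs_le.1 (abs_floor_div_mul_sub_le hτ0 hs)).1
          have h3 : (⌊s / τ n⌋₊ : ℝ) * τ n ≤ j * τ n := by gcongr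
          linarith
        have h2 := hR _ _ (hE.bdd n (j * τ n)) (hE.bdd n s) (hd n s (j * τ n) (by
          have : |j * τ n - s| ≤ t - s + τ n := by
            rw [abs_le]
            constructor <;> linarith
          linarith))
        rw [← hw] at h2
        have h3 := abs_sub_le (∫ x, g n (euler (ν n) (g n) (τ n) v j x) * diffOp (ν n) ψ x)
          (∫ x, φ (euler (ν n) (g n) (τ n) v j x) * A ψ x)
          (∫ x, φ (interp ν g τ v n s x) * A ψ x)
        linarith)
    simp only [mul_comm (ψ _)] at key
    exact key

end

noncomputable section

variable {N : ℕ}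

/-- Bounds for a space-time test function that are uniform in time. -/
structure TimeBound (ψ : Euc N → ℝ → ℝ) (B R : ℝ) : Prop where
  abs_le : ∀ x t, |ψ x t| ≤ B
  abs_deriv_le : ∀ x t, |deriv (ψ x) t| ≤ B
  abs_sub_le : ∀ x s t, |ψ x t - ψ x s| ≤ B * |t - s|
  eq_zero : ∀ x t, R < ‖x‖ → ψ x t = 0

namespace IsSTTestFn

variable {T : ℝ} {ψ : Euc N → ℝ → ℝ}

lemma isTestFn (h : IsSTTestFn T ψ) (t : ℝ) : IsTestFn fun x => ψ x t := by
  refine ⟨h.1.comp (contDiff_id.prodMk contDiff_const), ?_⟩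
  obtain ⟨R, hR⟩ := exists_norm_bound_support h.2.1
  refine HasCompactSupport.intro (isCompact_closedBall (0 : Euc N) R) fun x hx => ?_
  refine hR (x, t) (lt_of_lt_of_le ?_ (norm_fst_le (x, t)))
  simpa using hx

lemma differentiable (h : IsSTTestFn T ψ) (x : Euc N) : Differentiable ℝ (ψ x) :=
  (h.1.comp (contDiff_const.prodMk contDiff_id)).differentiable (by simp)

lemma exists_timeBound (h : IsSTTestFn T ψ) : ∃ B R, TimeBound ψ B R := by
  obtain ⟨L, hL⟩ := h.1.lipschitzWith_of_hasCompactSupport h.2.1 (by simp)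
  obtain ⟨C, hC⟩ := h.2.1.exists_bound_of_continuous h.1.continuous
  obtain ⟨R, hR⟩ := exists_norm_bound_support h.2.1
  have hlip : ∀ x s t, |ψ x t - ψ x s| ≤ L * |t - s| := fun x s t => by
    simpa [Real.dist_eq, Prod.dist_eq] using hL.dist_le_mul (x, t) (x, s)
  refine ⟨max C L, R, fun x t => (hC (x, t)).trans (le_max_left _ _), fun x t => ?_,
    fun x s t => (hlip x s t).trans (by gcongr; exact le_max_right _ _),
    fun x t hx => hR (x, t) (hx.trans_le (norm_fst_le (x, t)))⟩
  refine le_trans ?_ (le_max_right _ _)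
  rw [← Real.norm_eq_abs]
  refine norm_deriv_le_of_lipschitz (LipschitzWith.of_dist_le_mul fun t s => ?_)
  simpa [Real.dist_eq] using hlip x s t

lemma apply_end_eq_zero (h : IsSTTestFn T ψ) (x : Euc N) : ψ x T = 0 := by
  refine image_eq_zero_of_notMem_tsupport (f := Function.uncurry ψ) (x := (x, T)) fun hx => ?_
  exact lt_irrefl T (h.2.2 hx)

lemma measurable_deriv (h : IsSTTestFn T ψ) (t : ℝ) : Measurable fun x => deriv (ψ x) t :=
  (measurable_deriv_with_param h.1.continuous).comp (measurable_id.prodMk measurable_const)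

end IsSTTestFn

lemma abs_integral_sub_mul_le {M c R : ℝ} {a b f : Euc N → ℝ} (ha : BddMeas M a)
    (hb : BddMeas M b) (hc : ∀ x, |f x| ≤ c) (hf : ∀ x, R < ‖x‖ → f x = 0) :
    |∫ x, (a x - b x) * f x| ≤ c * ballDist R a b := by
  rw [← setIntegral_eq_integral_of_forall_compl_eq_zero (s := Metric.closedBall (0 : Euc N) R)
    fun x hx => by rw [hf x (by simpa using hx), mul_zero], ballDist, ← integral_const_mul,
    ← Real.norm_eq_abs]
  refine norm_integral_le_of_norm_le
    (((ha.integrableOn R).sub (hb.integrableOn R)).abs.const_mul c)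
    (Eventually.of_forall fun x => ?_)
  rw [Real.norm_eq_abs, abs_mul, mul_comm]
  exact mul_le_mul_of_nonneg_right (hc x) (abs_nonneg _)

namespace WeakFlow

variable {A : (Euc N → ℝ) → Euc N → ℝ} {φ : ℝ → ℝ} {M : ℝ} {v : Euc N → ℝ} {u : Euc N → ℝ → ℝ}

lemma bddMeas (h : WeakFlow A φ M v u) (t : ℝ) : BddMeas M fun x => u x t :=
  ⟨h.meas.comp (measurable_id.prodMk measurable_const), fun x => h.bdd x t⟩

lemma memLinfQT (h : WeakFlow A φ M v u) (T : ℝ) : MemLinfQT T u :=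
  ⟨h.meas.aestronglyMeasurable, M, Eventually.of_forall fun p => h.bdd p.1 p.2⟩

lemma memL1QT (h : WeakFlow A φ M v u) (T : ℝ) : MemL1QT T u := by
  obtain ⟨I, hI⟩ := h.integral_le
  have hm : AEStronglyMeasurable (fun p : Euc N × ℝ => u p.1 p.2) (QTvol N T) :=
    h.meas.aestronglyMeasurable
  refine (integrable_prod_iff' hm).2 ⟨Eventually.of_forall h.integrable, ?_⟩
  refine Integrable.of_bound (hm.norm.prod_swap.integral_prod_right') I
    (Eventually.of_forall fun t => ?_)
  rw [Real.norm_of_nonneg (integral_nonneg fun _ => norm_nonneg _)]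
  exact hI t

lemma memCL1loc (h : WeakFlow A φ M v u) (T : ℝ) : MemCL1loc T u := by
  intro K hK
  refine ⟨fun t _ => (h.integrable t).integrableOn, fun t _ => ?_⟩
  obtain ⟨R, hR⟩ := hK.isBounded.subset_closedBall (0 : Euc N)
  rw [Metric.tendsto_nhds]
  intro ε hε
  obtain ⟨δ, hδ, hd⟩ := h.cont R (ε / 2) (half_pos hε)
  filter_upwards [mem_nhdsWithin_of_mem_nhds (Metric.ball_mem_nhds t hδ)] with s hs
  have h1 : ∫ x in K, |u x s - u x t| ≤ ballDist R (fun x => u x s) fun x => u x t :=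
    setIntegral_mono_set ((h.bddMeas s).integrableOn R |>.sub ((h.bddMeas t).integrableOn R)).abs
      (Eventually.of_forall fun _ => abs_nonneg _) hR.eventuallyLE
  rw [Real.dist_eq, sub_zero, abs_of_nonneg (integral_nonneg fun _ => abs_nonneg _)]
  linarith [hd t s hs]

variable {T : ℝ} {ψ : Euc N → ℝ → ℝ}

lemma integrable_mul (h : WeakFlow A φ M v u) (hψ : IsSTTestFn T ψ) (s t : ℝ) :
    Integrable fun x => u x s * ψ x t :=
  (hψ.isTestFn t).integrable.bdd_mul (h.bddMeas s).1.aestronglyMeasurable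
    (Eventually.of_forall (h.bddMeas s).2)

lemma hasDerivAt_integral (h : WeakFlow A φ M v u) (hψ : IsSTTestFn T ψ) (t : ℝ) :
    Integrable (fun x => u x t * deriv (ψ x) t) ∧
      HasDerivAt (fun s => ∫ x, u x t * ψ x s) (∫ x, u x t * deriv (ψ x) t) t := by
  obtain ⟨B, R, hB⟩ := hψ.exists_timeBound
  refine hasDerivAt_integral_of_dominated_loc_of_deriv_le (s := univ)
    (bound := fun x => |u x t| * B) (F' := fun s x => u x t * deriv (ψ x) s) univ_mem
    (Eventually.of_forall fun s => (h.integrable_mul hψ t s).aestronglyMeasurable)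
    (h.integrable_mul hψ t t)
    ((h.bddMeas t).1.mul (hψ.measurable_deriv t)).aestronglyMeasurable
    (Eventually.of_forall fun x s _ => ?_) ((h.integrable t).abs.mul_const B)
    (Eventually.of_forall fun x s _ => ((hψ.differentiable x s).hasDerivAt.const_mul _))
  rw [Real.norm_eq_abs, abs_mul]
  exact mul_le_mul_of_nonneg_left (hB.abs_deriv_le x s) (abs_nonneg _)

lemma continuous_integral_mul (h : WeakFlow A φ M v u) (hψ : IsSTTestFn T ψ) :
    Continuous fun t => ∫ x, u x t * ψ x t := by
  obtain ⟨B, R, hB⟩ := hψ.exists_timeBound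
  have hB0 : 0 ≤ B := (abs_nonneg _).trans (hB.abs_le 0 0)
  rw [continuous_iff_continuousAt]
  intro t
  have h1 : Tendsto (fun s => ∫ x, (u x s - u x t) * ψ x s) (𝓝 t) (𝓝 0) := by
    rw [Metric.tendsto_nhds]
    intro ε hε
    obtain ⟨δ, hδ, hd⟩ := h.cont R (ε / (2 * (B + 1))) (by positivity)
    filter_upwards [Metric.ball_mem_nhds t hδ] with s hs
    rw [Real.dist_eq, sub_zero]
    calc |∫ x, (u x s - u x t) * ψ x s|
        ≤ B * ballDist R (fun x => u x s) fun x => u x t :=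
          abs_integral_sub_mul_le (h.bddMeas s) (h.bddMeas t) (fun x => hB.abs_le x s)
            fun x => hB.eq_zero x s
      _ ≤ (B + 1) * (ε / (2 * (B + 1))) :=
          mul_le_mul (by linarith) (hd t s hs) (ballDist_nonneg _ _ _) (by linarith)
      _ = ε / 2 := by field_simp
      _ < ε := half_lt_self hε
  have h2 := h1.add (h.hasDerivAt_integral hψ t).2.continuousAt
  rw [zero_add] at h2
  refine h2.congr fun s => ?_
  simp only [sub_mul]
  rw [integral_sub (h.integrable_mul hψ s s) (h.integrable_mul hψ t s)]
  ring

lemma hasDerivWithinAt_integral_mul (h : WeakFlow A φ M v u) (hψ : IsSTTestFn T ψ) {t : ℝ}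
    (ht : 0 ≤ t) :
    HasDerivWithinAt (fun s => ∫ x, u x s * ψ x s)
      ((∫ x, u x t * deriv (ψ x) t) + ∫ x, φ (u x t) * A (fun y => ψ y t) x) (Ioi t) t := by
  obtain ⟨B, R, hB⟩ := hψ.exists_timeBound
  have hB0 : 0 ≤ B := (abs_nonneg _).trans (hB.abs_le 0 0)
  rw [hasDerivWithinAt_iff_isLittleO, Asymptotics.isLittleO_iff]
  intro c hc
  have h1 := hasDerivWithinAt_iff_isLittleO.1
    ((h.hasDerivAt_integral hψ t).2.hasDerivWithinAt (s := Ioi t))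
  obtain ⟨δ, hδ, hw⟩ := h.weak _ (hψ.isTestFn t) (c / 3) (by positivity)
  obtain ⟨η, hη, hd⟩ := h.cont R (c / (3 * (B + 1))) (by positivity)
  filter_upwards [Asymptotics.isLittleO_iff.1 h1 (show 0 < c / 3 by positivity),
    mem_nhdsWithin_of_mem_nhds (Metric.ball_mem_nhds t hδ),
    mem_nhdsWithin_of_mem_nhds (Metric.ball_mem_nhds t hη), self_mem_nhdsWithin] with s e1 e2 e3 e4
  have hts : t < s := e4
  have hpos : 0 < s - t := sub_pos.2 hts
  rw [Metric.mem_ball, Real.dist_eq] at e2 e3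
  have k2 := hw t s ht hts.le ((le_abs_self _).trans_lt e2)
  have k3 : |∫ x, (u x s - u x t) * (ψ x s - ψ x t)| ≤ c / 3 * (s - t) := by
    calc |∫ x, (u x s - u x t) * (ψ x s - ψ x t)|
        ≤ (B * |s - t|) * ballDist R (fun x => u x s) fun x => u x t :=
          abs_integral_sub_mul_le (h.bddMeas s) (h.bddMeas t) (fun x => hB.abs_sub_le x t s)
            fun x hx => by rw [hB.eq_zero x s hx, hB.eq_zero x t hx, sub_zero]
      _ ≤ ((B + 1) * |s - t|) * (c / (3 * (B + 1))) :=
          mul_le_mul (by gcongr; linarith) (hd t s e3) (ballDist_nonneg _ _ _) (by positivity)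
      _ = c / 3 * (s - t) := by rw [abs_of_pos hpos]; field_simp
  have hsplit : ∫ x, (u x s - u x t) * (ψ x s - ψ x t) =
      (∫ x, u x s * ψ x s) - (∫ x, u x s * ψ x t) - (∫ x, u x t * ψ x s) +
        ∫ x, u x t * ψ x t := by
    simp only [mul_sub, sub_mul]
    rw [integral_sub (f := fun x => u x s * ψ x s - u x t * ψ x s)
      (g := fun x => u x s * ψ x t - u x t * ψ x t)
      ((h.integrable_mul hψ s s).sub (h.integrable_mul hψ t s))
      ((h.integrable_mul hψ s t).sub (h.integrable_mul hψ t t)),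
      integral_sub (h.integrable_mul hψ s s) (h.integrable_mul hψ t s),
      integral_sub (h.integrable_mul hψ s t) (h.integrable_mul hψ t t)]
    ring
  simp only [Real.norm_eq_abs, smul_eq_mul, abs_of_pos hpos] at e1 ⊢
  rw [hsplit] at k3
  rw [abs_le] at *
  constructor <;> nlinarith

end WeakFlow

theorem WeakFlow.isDistSolOp {A : (Euc N → ℝ) → Euc N → ℝ} {φ : ℝ → ℝ} {M : ℝ} {v : Euc N → ℝ}
    {u : Euc N → ℝ → ℝ} (h : WeakFlow A φ M v u) {ν : ℕ → Measure (Euc N)} {Λ : ℝ}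
    (hA : OpApprox ν A Λ) (hφ : Continuous φ) {T : ℝ} (hT : 0 < T) :
    IsDistSolOp T A φ v u := by
  intro ψ hψ
  obtain ⟨B, R, hB⟩ := hψ.exists_timeBound
  obtain ⟨K, hK⟩ := hψ.exists_sdiffBound
  obtain ⟨I, hI⟩ := h.integral_le
  obtain ⟨C, hC⟩ := (isCompact_Icc (a := -M) (b := M)).exists_bound_of_continuousOn hφ.continuousOn
  have hφu : ∀ x t, |φ (u x t)| ≤ C := fun x t => hC _ (abs_le.1 (h.bdd x t))
  have hC0 : 0 ≤ C := (abs_nonneg _).trans (hφu 0 0)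
  have hB0 : 0 ≤ B := (abs_nonneg _).trans (hB.abs_le 0 0)
  have hinner : ∀ t, ∫ x, (u x t * deriv (ψ x) t + φ (u x t) * A (fun y => ψ y t) x) =
      (∫ x, u x t * deriv (ψ x) t) + ∫ x, φ (u x t) * A (fun y => ψ y t) x := fun t =>
    integral_add (h.hasDerivAt_integral hψ t).1
      ((hA.integrable (hψ.isTestFn t)).bdd_mul (c := C)
        (hφ.measurable.comp (h.bddMeas t).1).aestronglyMeasurable
        (Eventually.of_forall fun x => hφu x t))
  set F : ℝ → ℝ := fun t =>
    (∫ x, u x t * deriv (ψ x) t) + ∫ x, φ (u x t) * A (fun y => ψ y t) x with hF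
  have hder : ∀ t ∈ Ioo 0 T, HasDerivWithinAt (fun s => ∫ x, u x s * ψ x s) (F t) (Ioi t) t :=
    fun t ht => h.hasDerivWithinAt_integral_mul hψ ht.1.le
  have hFb : ∀ t, |F t| ≤ B * I + C * (K * Λ) := by
    intro t
    refine (abs_add_le _ _).trans (add_le_add ?_ ?_)
    · have h1 : |∫ x, u x t * deriv (ψ x) t| ≤ ∫ x, B * |u x t| := by
        rw [← Real.norm_eq_abs]
        refine norm_integral_le_of_norm_le ((h.integrable t).abs.const_mul B)
          (Eventually.of_forall fun x => ?_)
        rw [Real.norm_eq_abs, abs_mul, mul_comm]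
        exact mul_le_mul_of_nonneg_right (hB.abs_deriv_le x t) (abs_nonneg _)
      rw [integral_const_mul] at h1
      exact h1.trans (mul_le_mul_of_nonneg_left (hI t) hB0)
    · exact abs_integral_mul_le hC0 (mul_nonneg (hK t).nonneg hA.nonneg) (fun x => hφu x t)
        (hA.lintegral_le (hψ.isTestFn t) (hK t))
  have hFi : IntegrableOn F (Ioo 0 T) := by
    refine Integrable.of_bound ?_ (B * I + C * (K * Λ)) (Eventually.of_forall hFb)
    refine (measurable_derivWithin_Ioi fun s => ∫ x, u x s * ψ x s).aestronglyMeasurable.congr ?_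
    filter_upwards [ae_restrict_mem measurableSet_Ioo] with t ht
    exact (hder t ht).derivWithin (uniqueDiffWithinAt_Ioi t)
  have hftc := intervalIntegral.integral_eq_sub_of_hasDeriv_right (a := 0) (b := T) (f' := F)
    (h.continuous_integral_mul hψ).continuousOn
    (by simpa only [min_eq_left hT.le, max_eq_right hT.le] using hder)
    ((intervalIntegrable_iff_integrableOn_Ioo_of_le hT.le).2 hFi)
  rw [intervalIntegral.integral_of_le hT.le, integral_Ioc_eq_integral_Ioo] at hftc
  simp only [hinner]
  rw [hftc, h.init _ (hψ.isTestFn 0).integrable]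
  simp [hψ.apply_end_eq_zero]

end

noncomputable section

variable {N : ℕ}

lemma MemLinfRn.exists_bddMeas {u0 : Euc N → ℝ} (h : MemLinfRn u0) :
    ∃ M v, 0 ≤ M ∧ BddMeas M v ∧ v =ᵐ[volume] u0 := by
  obtain ⟨hm, C, hC⟩ := h
  refine ⟨|C|, fun x => max (-|C|) (min |C| (hm.mk u0 x)), abs_nonneg C, ⟨?_, fun x => ?_⟩, ?_⟩
  · have := hm.stronglyMeasurable_mk.measurable
    fun_prop
  · exact abs_le.2 ⟨le_max_left _ _,
      max_le (by linarith [abs_nonneg C]) (min_le_left _ _)⟩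
  · filter_upwards [hC, hm.ae_eq_mk] with x hx he
    have := abs_le.1 (hx.trans (le_abs_self C))
    rw [← he, min_eq_right this.2, max_eq_right this.1]

lemma OpApprox.exists_scheme {ν : ℕ → Measure (Euc N)} {A : (Euc N → ℝ) → Euc N → ℝ} {Λ : ℝ}
    (h : OpApprox ν A Λ) {φ : ℝ → ℝ} (hc : Continuous φ) (hm : Monotone φ) {M : ℝ} (hM : 0 ≤ M)
    {v : Euc N → ℝ} (hv : BddMeas M v) (hi : Integrable v) :
    ∃ C g τ, Scheme ν A Λ φ M C g τ v := by
  choose g L hL hgc hgm hgb hgφ hgl using fun n : ℕ =>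
    exists_lipschitz_approx hc hm hM (ε := 1 / ((n : ℝ) + 1)) (by positivity)
  have hpos : ∀ n, 0 < L n * (ν n).real univ + 1 := fun n =>
    add_pos_of_nonneg_of_pos (mul_nonneg (hL n) measureReal_nonneg) one_pos
  refine ⟨_, g, fun n => min (1 / ((n : ℝ) + 1)) (1 / (L n * (ν n).real univ + 1)), h, hc,
    fun n => ⟨h.finite n, h.symm n, hgm n, hgb n, ?_, hgc n, fun a b hab => ?_⟩,
    fun n => min_le_left _ _, fun n => hgφ n, hv, hi⟩
  · exact lt_min (by positivity) (one_div_pos.2 (hpos n))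
  · have hν : 0 ≤ (ν n).real univ := measureReal_nonneg
    have hg : 0 ≤ g n b - g n a := sub_nonneg.2 (hgm n hab)
    calc min (1 / ((n : ℝ) + 1)) (1 / (L n * (ν n).real univ + 1)) * (ν n).real univ *
          (g n b - g n a)
        ≤ 1 / (L n * (ν n).real univ + 1) * (ν n).real univ * (L n * (b - a)) := by
          have := hpos n
          gcongr
          · exact min_le_right _ _
          · exact hgl n a b hab
      _ = L n * (ν n).real univ / (L n * (ν n).real univ + 1) * (b - a) := by ring
      _ ≤ 1 * (b - a) := by
          gcongr
          rw [div_le_one (hpos n)]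
          linarith
      _ = b - a := one_mul _

end

/-- Existence for general symmetric Lévy generators (Corollary 2.14).
There exists a distributional solution `u ∈ L^∞(Q_T) ∩ L¹(Q_T) ∩ C([0,T];L¹_loc(ℝ^N))` of
`∂_t u − (L^σ + L^μ)[φ(u)] = 0` with initial datum `u₀`. -/
theorem existence_for_general_levy_generators
    (N : ℕ) (hN : 0 < N) (T : ℝ) (hT : 0 < T)
    (φ : ℝ → ℝ) (hφc : Continuous φ) (hφm : Monotone φ)
    (μ : Measure (Euc N)) (hμ : IsLevyMeasure μ)
    (P : ℕ) (σ : Fin P → Euc N)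
    (u0 : Euc N → ℝ)
    (hu0inf : MemLinfRn u0) (hu01 : Integrable u0 (volume : Measure (Euc N))) :
    ∃ u : Euc N → ℝ → ℝ,
      MemLinfQT T u ∧ MemL1QT T u ∧ MemCL1loc T u ∧
      IsDistSolOp T (fun ψ x => Lsigma P σ ψ x + Lop μ ψ x) φ u0 u := by
  obtain ⟨M, v, hM, hv, hvu⟩ := hu0inf.exists_bddMeas
  obtain ⟨Λ, hA⟩ := opApprox_levyApprox P σ hμ
  obtain ⟨C, g, τ, hS⟩ := hA.exists_scheme hφc hφm hM hv (hu01.congr hvu.symm)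
  obtain ⟨u, hu⟩ := hS.exists_weakFlow
  refine ⟨u, hu.memLinfQT T, hu.memL1QT T, hu.memCL1loc T, fun ψ hψ => ?_⟩
  have h0 : ∫ x, u0 x * ψ x 0 = ∫ x, v x * ψ x 0 := by
    refine integral_congr_ae ?_
    filter_upwards [hvu] with x hx
    rw [hx]
  rw [h0]
  exact hu.isDistSolOp hA hφc hT ψ hψ
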